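/- arXiv:2308.05299 — 4 statements merged into one kernel-verified Lean document; each statement's English description precedes it below -/
import Mathlib

section
/- Let Γ be a torsion-free commutative cancellative monoid with trivial group of units (Γ ∩ (−Γ) = {0}) and let R be a Γ-graded domain with 0th graded component R₀. Suppose that every graded overring of R that is flat as an R-module is a localization of R. Then every overring of R₀ that is flat as an R₀-module is a localization of R₀. -/
/-! Core definitions for graded perinormality, following Epstein–Shapiro style graded notions. -/

section Core

variable {ι : Type*} [DecidableEq ι] [AddCommMonoid ι]
variable {R : Type*} [CommRing R]

/-- `𝒜` is a grading of the ring `R` by the (torsionless) monoid `ι`: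
the components multiply correctly and give an internal direct sum decomposition. -/
structure IsGrRing (𝒜 : ι → AddSubgroup R) : Prop where
  one_mem : (1 : R) ∈ 𝒜 0
  mul_mem : ∀ {i j : ι} {a b : R}, a ∈ 𝒜 i → b ∈ 𝒜 j → a * b ∈ 𝒜 (i + j)
  internal : DirectSum.IsInternal 𝒜

/-- An ideal of `R` is homogeneous iff every element of it is a finite sum of
homogeneous elements of the ideal. -/
def IsHomIdeal (𝒜 : ι → AddSubgroup R) (I : Ideal R) : Prop :=
  ∀ x ∈ I, x ∈ AddSubmonoid.closure {y : R | SetLike.IsHomogeneousElem 𝒜 y ∧ y ∈ I}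

/-- A graded (homogeneous) maximal ideal: maximal among proper homogeneous ideals. -/
def IsGrMaxIdeal (𝒜 : ι → AddSubgroup R) (I : Ideal R) : Prop :=
  IsHomIdeal 𝒜 I ∧ I ≠ ⊤ ∧ ∀ J : Ideal R, IsHomIdeal 𝒜 J → I ≤ J → J ≠ ⊤ → J = I

/-- `R` is gr-local: it has exactly one graded maximal ideal. -/
def GrLocal (𝒜 : ι → AddSubgroup R) : Prop :=
  ∃! I : Ideal R, IsGrMaxIdeal 𝒜 I

/-- A prime ideal of height one (in a domain). -/
def HeightOnePrime (P : Ideal R) : Prop :=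
  P.IsPrime ∧ P ≠ ⊥ ∧ ∀ Q : Ideal R, Q.IsPrime → Q < P → Q = ⊥

variable [IsDomain R]

/-- A homogeneous element of the graded quotient field of `R`, i.e. a quotient of two
homogeneous elements of `R` (viewed inside the full quotient field). -/
def IsHomFrac (𝒜 : ι → AddSubgroup R) (x : FractionRing R) : Prop :=
  ∃ (i j : ι) (a b : R), a ∈ 𝒜 i ∧ b ∈ 𝒜 j ∧ b ≠ 0 ∧
    x * algebraMap R (FractionRing R) b = algebraMap R (FractionRing R) a

/-- `S` is a graded overring of `R`: a ring between `R` and the graded quotient field that is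
the sum of its homogeneous components, i.e. each of its elements is a finite sum of
homogeneous elements of `S`. -/
def IsGradedOverring (𝒜 : ι → AddSubgroup R) (S : Subalgebra R (FractionRing R)) : Prop :=
  ∀ x ∈ S, x ∈ AddSubmonoid.closure {y : FractionRing R | y ∈ S ∧ IsHomFrac 𝒜 y}

/-- A homogeneous ideal of an overring `S` of `R`. -/
def IsHomIdealOver (𝒜 : ι → AddSubgroup R) (S : Subalgebra R (FractionRing R))
    (I : Ideal S) : Prop :=
  ∀ x ∈ I, (x : FractionRing R) ∈ AddSubmonoid.closure
    {y : FractionRing R | IsHomFrac 𝒜 y ∧ ∃ h : y ∈ S, (⟨y, h⟩ : S) ∈ I}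

/-- A graded maximal ideal of an overring. -/
def IsGrMaxIdealOver (𝒜 : ι → AddSubgroup R) (S : Subalgebra R (FractionRing R))
    (I : Ideal S) : Prop :=
  IsHomIdealOver 𝒜 S I ∧ I ≠ ⊤ ∧
    ∀ J : Ideal S, IsHomIdealOver 𝒜 S J → I ≤ J → J ≠ ⊤ → J = I

/-- The overring `S` is gr-local. -/
def GrLocalOver (𝒜 : ι → AddSubgroup R) (S : Subalgebra R (FractionRing R)) : Prop :=
  ∃! I : Ideal S, IsGrMaxIdealOver 𝒜 S I

/-- `S` satisfies graded going-down (gGD) over `R`. -/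
def GGD (𝒜 : ι → AddSubgroup R) (S : Subalgebra R (FractionRing R)) : Prop :=
  ∀ (P Q : Ideal R) (Qt : Ideal S), P.IsPrime → Q.IsPrime → Qt.IsPrime →
    IsHomIdeal 𝒜 P → IsHomIdeal 𝒜 Q → IsHomIdealOver 𝒜 S Qt → P ≤ Q →
    Qt.comap (algebraMap R S) = Q →
    ∃ Pt : Ideal S, Pt.IsPrime ∧ IsHomIdealOver 𝒜 S Pt ∧ Pt ≤ Qt ∧
      Pt.comap (algebraMap R S) = P

/-- The overring `S` is a localization of `R` (at some multiplicative subset `W` of `R`). -/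
def IsLocalizationOfR (S : Subalgebra R (FractionRing R)) : Prop :=
  ∃ W : Submonoid R, (∀ w ∈ W, IsUnit (algebraMap R S w)) ∧
    ∀ s : S, ∃ (r w : R), w ∈ W ∧ s * algebraMap R S w = algebraMap R S r

/-- `R` is a graded perinormal domain: every gr-local graded overring satisfying gGD is a
localization of `R`. -/
def GradedPerinormal (𝒜 : ι → AddSubgroup R) : Prop :=
  ∀ S : Subalgebra R (FractionRing R),
    IsGradedOverring 𝒜 S → GrLocalOver 𝒜 S → GGD 𝒜 S → IsLocalizationOfR S

/-- `R` is a graded globally perinormal domain: every graded overring satisfying gGD is a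
localization of `R`. -/
def GradedGloballyPerinormal (𝒜 : ι → AddSubgroup R) : Prop :=
  ∀ S : Subalgebra R (FractionRing R),
    IsGradedOverring 𝒜 S → GGD 𝒜 S → IsLocalizationOfR S

/-- The homogeneous localization `R_(P)` of `R` at an ideal `P`: the subring of the graded
quotient field consisting of fractions with homogeneous denominator outside `P`. -/
def HomLocR (𝒜 : ι → AddSubgroup R) (P : Ideal R) : Subalgebra R (FractionRing R) :=
  Algebra.adjoin R {x : FractionRing R | ∃ a w : R, SetLike.IsHomogeneousElem 𝒜 w ∧ w ∉ P ∧
    x * algebraMap R (FractionRing R) w = algebraMap R (FractionRing R) a}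

/-- The homogeneous localization `S_(Q)` of an overring `S` at an ideal `Q` of `S`. -/
def HomLocOver (𝒜 : ι → AddSubgroup R) (S : Subalgebra R (FractionRing R)) (Q : Ideal S) :
    Subalgebra R (FractionRing R) :=
  Algebra.adjoin R {x : FractionRing R | ∃ s w : S, IsHomFrac 𝒜 (w : FractionRing R) ∧
    w ∉ Q ∧ x * (w : FractionRing R) = (s : FractionRing R)}

/-- The localization `R_W` of `R` at a multiplicative set `W`, as a subring of the quotient
field. -/
def LocW (W : Submonoid R) : Subalgebra R (FractionRing R) :=
  Algebra.adjoin R {x : FractionRing R | ∃ r : R, ∃ w ∈ W,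
    x * algebraMap R (FractionRing R) w = algebraMap R (FractionRing R) r}

/-- A subring `V` of the graded quotient field (containing `R`) is a gr-valuation domain:
for every nonzero homogeneous `x` of the graded quotient field, `x ∈ V` or `x⁻¹ ∈ V`. -/
def GrValuation (𝒜 : ι → AddSubgroup R) (V : Subalgebra R (FractionRing R)) : Prop :=
  ∀ x : FractionRing R, x ≠ 0 → IsHomFrac 𝒜 x → x ∈ V ∨ x⁻¹ ∈ V

/-- `R` is a gr-(R₁) domain: the homogeneous localization at every height-one homogeneous
prime is a gr-valuation domain. -/
def GrR1 (𝒜 : ι → AddSubgroup R) : Prop :=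
  ∀ P : Ideal R, HeightOnePrime P → IsHomIdeal 𝒜 P → GrValuation 𝒜 (HomLocR 𝒜 P)

/-- The ideal `I` of `T` is the contraction of the ideal `J` of `S` (that is, `I = J ∩ T`
inside the common quotient field). -/
def Contracts (T S : Subalgebra R (FractionRing R)) (J : Ideal S) (I : Ideal T) : Prop :=
  ∀ x : FractionRing R,
    (∃ h : x ∈ T, (⟨x, h⟩ : T) ∈ I) ↔ (x ∈ T ∧ ∃ h : x ∈ S, (⟨x, h⟩ : S) ∈ J)

/-- `S` satisfies graded going-down over the intermediate ring `T`. -/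
def GGDSub (𝒜 : ι → AddSubgroup R) (T S : Subalgebra R (FractionRing R)) : Prop :=
  ∀ (P Q : Ideal T) (Qt : Ideal S), P.IsPrime → Q.IsPrime → Qt.IsPrime →
    IsHomIdealOver 𝒜 T P → IsHomIdealOver 𝒜 T Q → IsHomIdealOver 𝒜 S Qt → P ≤ Q →
    Contracts T S Qt Q →
    ∃ Pt : Ideal S, Pt.IsPrime ∧ IsHomIdealOver 𝒜 S Pt ∧ Pt ≤ Qt ∧ Contracts T S Pt P

/-- `S` is a localization of the intermediate ring `T` at a multiplicative subset of `T`. -/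
def IsLocalizationOfSub (T S : Subalgebra R (FractionRing R)) : Prop :=
  ∃ W : Submonoid (FractionRing R), (W : Set (FractionRing R)) ⊆ T ∧
    (∀ w ∈ W, ∃ y ∈ S, w * y = 1) ∧ ∀ s ∈ S, ∃ t ∈ T, ∃ w ∈ W, s * w = t

/-- The intermediate ring `T` (e.g. a homogeneous localization of `R`) is a graded
perinormal domain. -/
def GradedPerinormalSub (𝒜 : ι → AddSubgroup R) (T : Subalgebra R (FractionRing R)) : Prop :=
  ∀ S : Subalgebra R (FractionRing R), T ≤ S → IsGradedOverring 𝒜 S → GrLocalOver 𝒜 S →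
    GGDSub 𝒜 T S → IsLocalizationOfSub T S

/-- The intermediate ring `T` is a graded globally perinormal domain. -/
def GradedGloballyPerinormalSub (𝒜 : ι → AddSubgroup R)
    (T : Subalgebra R (FractionRing R)) : Prop :=
  ∀ S : Subalgebra R (FractionRing R), T ≤ S → IsGradedOverring 𝒜 S →
    GGDSub 𝒜 T S → IsLocalizationOfSub T S

/-- `R` is a gr-essential domain: `R` is the intersection of homogeneous localizations at a
family of homogeneous primes, each of which is a gr-valuation domain. -/
def GrEssential (𝒜 : ι → AddSubgroup R) : Prop :=
  ∃ I : Set (Ideal R),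
    (∀ P ∈ I, P.IsPrime ∧ IsHomIdeal 𝒜 P ∧ GrValuation 𝒜 (HomLocR 𝒜 P)) ∧
    ((⊥ : Subalgebra R (FractionRing R)) : Set (FractionRing R)) =
      ⋂ P ∈ I, (HomLocR 𝒜 P : Set (FractionRing R))

/-- The intermediate ring `T` is a gr-essential domain. -/
def GrEssentialSub (𝒜 : ι → AddSubgroup R) (T : Subalgebra R (FractionRing R)) : Prop :=
  ∃ I : Set (Ideal T),
    (∀ P ∈ I, P.IsPrime ∧ IsHomIdealOver 𝒜 T P ∧ GrValuation 𝒜 (HomLocOver 𝒜 T P)) ∧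
    (T : Set (FractionRing R)) = ⋂ P ∈ I, (HomLocOver 𝒜 T P : Set (FractionRing R))

end Core

/-- The 0th graded component of a graded ring, as a subring. -/
def ZeroPart {ι : Type*} [AddCommMonoid ι] {R : Type*} [CommRing R]
    (𝒜 : ι → AddSubgroup R) : Subring R :=
  Subring.closure (𝒜 0)

open scoped TensorProduct

section Extension

variable {k R : Type*} [CommRing k] [CommRing R] [Algebra k R]

/-- The multiplication map `R ⊗ A → Frac R` attached to an overring `A` of `k` and an embedding of
`Frac k` into `Frac R`. Its range is the extension `AR`. -/
noncomputable def overringExtension (φ : FractionRing k →ₐ[k] FractionRing R)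
    (A : Subalgebra k (FractionRing k)) : R ⊗[k] A →ₐ[R] FractionRing R :=
  Algebra.TensorProduct.lift (Algebra.ofId R (FractionRing R)) (φ.comp A.val)
    fun _ _ => Commute.all _ _

theorem overringExtension_tmul (φ : FractionRing k →ₐ[k] FractionRing R)
    (A : Subalgebra k (FractionRing k)) (r : R) (a : A) :
    overringExtension φ A (r ⊗ₜ a) = algebraMap R (FractionRing R) r * φ a :=
  rfl

/-- Tensoring an overring of `k` with a field containing `k` yields only pure tensors `x ⊗ 1`. -/
theorem exists_eq_tmul_one [IsDomain k] [IsDomain R] [FaithfulSMul k R]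
    (A : Subalgebra k (FractionRing k))
    (t : FractionRing R ⊗[k] A) : ∃ x : FractionRing R, t = x ⊗ₜ 1 := by
  induction t with
  | zero => exact ⟨0, (TensorProduct.zero_tmul _ _).symm⟩
  | add s t hs ht =>
    obtain ⟨x, rfl⟩ := hs
    obtain ⟨y, rfl⟩ := ht
    exact ⟨x + y, (TensorProduct.add_tmul _ _ _).symm⟩
  | tmul x a =>
    obtain ⟨p, q, hq, hpq⟩ := IsFractionRing.div_surjective (A := k) (a : FractionRing k)
    have hq₀ : q ≠ 0 := nonZeroDivisors.ne_zero hq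
    have hqk : algebraMap k (FractionRing k) q ≠ 0 := by simpa using hq₀
    have hqR : algebraMap k (FractionRing R) q ≠ 0 := by
      rw [IsScalarTower.algebraMap_apply k R (FractionRing R)]
      simpa using hq₀
    have hqa : q • a = p • (1 : A) := by
      apply Subtype.ext
      change q • (a : FractionRing k) = p • (1 : FractionRing k)
      rw [Algebra.smul_def, Algebra.smul_def, ← hpq, mul_div_cancel₀ _ hqk, mul_one]
    have hx : x = q • (x / algebraMap k (FractionRing R) q) := by
      rw [Algebra.smul_def]
      field_simp
    refine ⟨p • (x / algebraMap k (FractionRing R) q), ?_⟩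
    conv_lhs => rw [hx]
    rw [TensorProduct.smul_tmul, hqa, TensorProduct.smul_tmul]

theorem overringExtension_injective [IsDomain k] [IsDomain R] [FaithfulSMul k R]
    (φ : FractionRing k →ₐ[k] FractionRing R) (A : Subalgebra k (FractionRing k))
    [Module.Flat k A] : Function.Injective (overringExtension φ A) := by
  let j : R →ₗ[k] FractionRing R := (IsScalarTower.toAlgHom k R (FractionRing R)).toLinearMap
  have hj : Function.Injective (j.rTensor A) :=
    Module.Flat.rTensor_preserves_injective_linearMap j
      (IsFractionRing.injective R (FractionRing R))
  let m : FractionRing R ⊗[k] A →ₐ[k] FractionRing R :=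
    Algebra.TensorProduct.lift (AlgHom.id k (FractionRing R)) (φ.comp A.val)
      fun _ _ => Commute.all _ _
  have hm : Function.Injective m := by
    rw [injective_iff_map_eq_zero]
    intro t ht
    obtain ⟨x, rfl⟩ := exists_eq_tmul_one A t
    have hx : x = 0 := by simpa [m] using ht
    rw [hx, TensorProduct.zero_tmul]
  have hmj : ∀ t, overringExtension φ A t = m (j.rTensor A t) := by
    intro t
    induction t with
    | zero => simp
    | add s t hs ht => simp only [map_add, hs, ht]
    | tmul r a => rfl
  intro s t hst
  rw [hmj, hmj] at hst
  exact hj (hm hst)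

/-- If `k` is a retract of `R` and `AR ≅ R ⊗ A` is a localization of `R`, then `A` is a
localization of `k`. -/
theorem isLocalizationOfR_of_range_overringExtension (φ : FractionRing k →ₐ[k] FractionRing R)
    (A : Subalgebra k (FractionRing k)) (π : R →ₐ[k] k)
    (hinj : Function.Injective (overringExtension φ A))
    (hloc : IsLocalizationOfR (overringExtension φ A).range) : IsLocalizationOfR A := by
  obtain ⟨W, hunit, hfrac⟩ := hloc
  let e := AlgEquiv.ofInjective (overringExtension φ A) hinj
  let ρ : R ⊗[k] A →ₐ[k] A :=
    Algebra.TensorProduct.lift ((Algebra.ofId k A).comp π) (AlgHom.id k A)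
      fun _ _ => Commute.all _ _
  have hρ : ∀ r : R, ρ (algebraMap R (R ⊗[k] A) r) = algebraMap k A (π r) := by
    intro r
    simp [ρ, Algebra.TensorProduct.algebraMap_apply, Algebra.ofId_apply]
  refine ⟨W.map π, ?_, ?_⟩
  · rintro _ ⟨w, hw, rfl⟩
    have h := ((hunit w hw).map e.symm).map ρ
    rw [AlgEquiv.commutes, hρ] at h
    exact h
  · intro a
    obtain ⟨r, w, hw, h⟩ := hfrac (e (1 ⊗ₜ a))
    refine ⟨π r, π w, ⟨w, hw, rfl⟩, ?_⟩
    have h' := congrArg (fun s => ρ (e.symm s)) h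
    simp only [map_mul, AlgEquiv.symm_apply_apply, AlgEquiv.commutes, hρ] at h'
    simpa [ρ] using h'

end Extension

section ZeroPart

variable {Γ : Type*} [DecidableEq Γ] [AddCancelCommMonoid Γ]
variable {R : Type*} [CommRing R]

/-- If the degree monoid has no nontrivial units, the projection onto the 0th component is a ring
endomorphism. -/
theorem exists_projZero (hU : ∀ a b : Γ, a + b = 0 → a = 0) (𝒜 : Γ → AddSubgroup R)
    (hGr : IsGrRing 𝒜) :
    ∃ p : R →+* R, (∀ x, p x ∈ 𝒜 0) ∧ ∀ x ∈ 𝒜 0, p x = x := by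
  let _ : PartialOrder Γ :=
    { le := fun a b => ∃ c, b = a + c
      le_refl := fun a => ⟨0, (add_zero a).symm⟩
      le_trans := by
        rintro a _ _ ⟨c, rfl⟩ ⟨d, rfl⟩
        exact ⟨c + d, add_assoc _ _ _⟩
      le_antisymm := by
        rintro a _ ⟨c, rfl⟩ ⟨d, hd⟩
        have hcd : c + d = 0 := by
          rw [add_assoc] at hd
          exact left_eq_add.mp hd
        rw [hU c d hcd, add_zero] }
  have : CanonicallyOrderedAdd Γ :=
    { exists_add_of_le := fun h => h
      le_add_self := fun a b => ⟨b, add_comm b a⟩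
      le_self_add := fun _ b => ⟨b, rfl⟩ }
  let _ : GradedRing 𝒜 :=
    { hGr.internal.chooseDecomposition with
      one_mem := hGr.one_mem
      mul_mem := fun _ _ _ _ ha hb => hGr.mul_mem ha hb }
  exact ⟨GradedRing.projZeroRingHom 𝒜, fun x => SetLike.coe_mem _,
    fun x hx => DirectSum.decompose_of_mem_same 𝒜 hx⟩

/-- If the degree monoid has no nontrivial units, the 0th component is a retract. -/
theorem exists_zeroPart_retraction (hU : ∀ a b : Γ, a + b = 0 → a = 0)
    (𝒜 : Γ → AddSubgroup R) (hGr : IsGrRing 𝒜) :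
    ∃ π : R →ₐ[ZeroPart 𝒜] ZeroPart 𝒜, ∀ x, (π x : R) ∈ 𝒜 0 := by
  obtain ⟨p, hp₀, hp⟩ := exists_projZero hU 𝒜 hGr
  have hid : Set.EqOn p (RingHom.id R) (ZeroPart 𝒜) := RingHom.eqOn_set_closure hp
  exact ⟨{ p.codRestrict (ZeroPart 𝒜) fun x => Subring.subset_closure (hp₀ x) with
    commutes' := fun r => Subtype.ext (hid r.2) }, hp₀⟩

theorem isGradedOverring_range_overringExtension [IsDomain R] (𝒜 : Γ → AddSubgroup R)
    (hGr : IsGrRing 𝒜) (h₀ : ∀ x : ZeroPart 𝒜, (x : R) ∈ 𝒜 0)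
    (φ : FractionRing (ZeroPart 𝒜) →ₐ[ZeroPart 𝒜] FractionRing R)
    (A : Subalgebra (ZeroPart 𝒜) (FractionRing (ZeroPart 𝒜))) :
    IsGradedOverring 𝒜 (overringExtension φ A).range := by
  rintro _ ⟨t, rfl⟩
  change overringExtension φ A t ∈ _
  induction t with
  | zero => rw [map_zero]; exact zero_mem _
  | add s t hs ht => rw [map_add]; exact add_mem hs ht
  | tmul r a =>
    obtain ⟨d, rfl⟩ := hGr.internal.2 r
    induction d using DirectSum.induction_on with
    | zero => rw [map_zero, TensorProduct.zero_tmul, map_zero]; exact zero_mem _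
    | add c d hc hd =>
      rw [map_add, TensorProduct.add_tmul, map_add]
      exact add_mem hc hd
    | of i x =>
      rw [DirectSum.coeAddMonoidHom_of]
      refine AddSubmonoid.subset_closure ⟨⟨_, rfl⟩, ?_⟩
      obtain ⟨p, q, hq, hpq⟩ :=
        IsFractionRing.div_surjective (A := ZeroPart 𝒜) (a : FractionRing (ZeroPart 𝒜))
      have hq₀ : q ≠ 0 := nonZeroDivisors.ne_zero hq
      have hqk : algebraMap (ZeroPart 𝒜) (FractionRing (ZeroPart 𝒜)) q ≠ 0 := by simpa using hq₀
      refine ⟨i + 0, 0, x * p, q, hGr.mul_mem x.2 (h₀ p), h₀ q, by simpa using hq₀, ?_⟩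
      have hφ : ∀ x : ZeroPart 𝒜, algebraMap R (FractionRing R) x =
          φ (algebraMap (ZeroPart 𝒜) (FractionRing (ZeroPart 𝒜)) x) := fun x => by
        rw [AlgHom.commutes]
        rfl
      rw [overringExtension_tmul, map_mul, hφ, hφ, mul_assoc, ← map_mul, ← hpq,
        div_mul_cancel₀ _ hqk]

end ZeroPart

set_option synthInstance.maxHeartbeats 1000000 in
set_option maxHeartbeats 1600000 in
/-- Let `Γ` be a torsion-free commutative cancellative monoid with trivial
group of units and let `R` be a `Γ`-graded domain with 0th graded component `R₀`. If every
graded overring of `R` that is flat over `R` is a localization of `R`, then every overring of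
`R₀` that is flat over `R₀` is a localization of `R₀`. -/
theorem flat_overring_loc_descends_to_zeroPart
    {Γ : Type*} [DecidableEq Γ] [AddCancelCommMonoid Γ]
    (hTF : ∀ (k : ℕ) (a b : Γ), k ≠ 0 → k • a = k • b → a = b)
    (hU : ∀ a b : Γ, a + b = 0 → a = 0)
    {R : Type*} [CommRing R] [IsDomain R]
    (𝒜 : Γ → AddSubgroup R) (hGr : IsGrRing 𝒜)
    (hyp : ∀ S : Subalgebra R (FractionRing R), IsGradedOverring 𝒜 S →
      Module.Flat R S → IsLocalizationOfR S) :
    ∀ A : Subalgebra (ZeroPart 𝒜) (FractionRing (ZeroPart 𝒜)),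
      Module.Flat (ZeroPart 𝒜) A → IsLocalizationOfR A := by
  intro A hA
  obtain ⟨π, hπ⟩ := exists_zeroPart_retraction hU 𝒜 hGr
  have h₀ : ∀ x : ZeroPart 𝒜, (x : R) ∈ 𝒜 0 := fun x => by
    have h := hπ (algebraMap (ZeroPart 𝒜) R x)
    rwa [AlgHom.commutes] at h
  have hinj : Function.Injective (Algebra.ofId (ZeroPart 𝒜) (FractionRing R)) :=
    (IsFractionRing.injective R (FractionRing R)).comp Subtype.val_injective
  let φ : FractionRing (ZeroPart 𝒜) →ₐ[ZeroPart 𝒜] FractionRing R :=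
    IsFractionRing.liftAlgHom hinj
  have hext := overringExtension_injective φ A
  refine isLocalizationOfR_of_range_overringExtension φ A π hext (hyp _ ?_ ?_)
  · exact isGradedOverring_range_overringExtension 𝒜 hGr h₀ φ A
  · exact Module.Flat.of_linearEquiv
      (AlgEquiv.ofInjective (overringExtension φ A) hext).symm.toLinearEquiv
end

section
/- Let Γ be a torsion-free commutative cancellative monoid with trivial group of units (Γ ∩ (−Γ) = {0}) and let R be a Γ-graded domain with 0th graded component R₀. If R is a graded globally perinormal domain and R₀ is a perinormal domain, then R₀ is a globally perinormal domain. -/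
/-- An overring `S` of the domain `R` satisfies going-down. -/
def GoingDownOver {R : Type*} [CommRing R] [IsDomain R]
    (S : Subalgebra R (FractionRing R)) : Prop :=
  ∀ (P Q : Ideal R) (Qt : Ideal S), P.IsPrime → Q.IsPrime → Qt.IsPrime → P ≤ Q →
    Qt.comap (algebraMap R S) = Q →
    ∃ Pt : Ideal S, Pt.IsPrime ∧ Pt ≤ Qt ∧ Pt.comap (algebraMap R S) = P

/-- A domain is perinormal if every local going-down overring is a localization of it. -/
def Perinormal (R : Type*) [CommRing R] [IsDomain R] : Prop :=
  ∀ S : Subalgebra R (FractionRing R), IsLocalRing S → GoingDownOver S → IsLocalizationOfR S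

/-- A domain is globally perinormal if every going-down overring is a localization of it. -/
def GloballyPerinormal (R : Type*) [CommRing R] [IsDomain R] : Prop :=
  ∀ S : Subalgebra R (FractionRing R), GoingDownOver S → IsLocalizationOfR S

theorem mem_zeroPart_iff {ι : Type*} [DecidableEq ι] [AddCommMonoid ι] {R : Type*} [CommRing R]
    (𝒜 : ι → AddSubgroup R) [GradedRing 𝒜] {x : R} : x ∈ ZeroPart 𝒜 ↔ x ∈ 𝒜 0 := by
  refine ⟨fun hx => ?_, fun hx => Subring.subset_closure hx⟩
  have h : ZeroPart 𝒜 ≤ SetLike.GradeZero.subring 𝒜 :=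
    Subring.closure_le.2 fun y hy => hy
  exact h hx

/-- The localization of a going-down overring at a prime again satisfies going-down. -/
theorem GoingDownOver.of_isLocalization_atPrime {A : Type*} [CommRing A] [IsDomain A]
    {T : Subalgebra A (FractionRing A)} (hT : GoingDownOver T) (M : Ideal T) [M.IsPrime]
    (B : Type*) [CommRing B] [Algebra T B] [Algebra A B] [IsScalarTower A T B]
    [IsLocalization.AtPrime B M] (P Q : Ideal A) (Qt : Ideal B) (hP : P.IsPrime)
    (hQ : Q.IsPrime) (hQt : Qt.IsPrime) (hPQ : P ≤ Q) (hc : Qt.comap (algebraMap A B) = Q) :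
    ∃ Pt : Ideal B, Pt.IsPrime ∧ Pt ≤ Qt ∧ Pt.comap (algebraMap A B) = P := by
  have hcomp (I : Ideal B) :
      (I.comap (algebraMap T B)).comap (algebraMap A T) = I.comap (algebraMap A B) := by
    rw [Ideal.comap_comap, ← IsScalarTower.algebraMap_eq]
  obtain ⟨P₁, hP₁, hle, hP₁c⟩ := hT P Q (Qt.comap (algebraMap T B)) hP hQ (hQt.comap _) hPQ
    ((hcomp Qt).trans hc)
  have hdisj : Disjoint (M.primeCompl : Set T) (P₁ : Set T) := by
    rw [Set.disjoint_left]
    intro x hx hxP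
    exact hQt.ne_top (Qt.eq_top_of_isUnit_mem (hle hxP)
      (IsLocalization.map_units B (⟨x, hx⟩ : M.primeCompl)))
  refine ⟨P₁.map (algebraMap T B),
    IsLocalization.isPrime_of_isPrime_disjoint M.primeCompl B P₁ hP₁ hdisj,
    Ideal.map_le_iff_le_comap.2 hle, ?_⟩
  rw [← hcomp]
  have := IsLocalization.under_map_of_isPrime_disjoint M.primeCompl B hP₁ hdisj
  rw [Ideal.under_def] at this
  rw [this, hP₁c]

/-- Elements of a going-down overring of a perinormal domain have, locally at each prime,
denominators in the base. -/
theorem Perinormal.exists_denominator {A : Type*} [CommRing A] [IsDomain A] (hA : Perinormal A)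
    {T : Subalgebra A (FractionRing A)} (hT : GoingDownOver T) (M : Ideal T) [M.IsPrime]
    (t : T) :
    ∃ w r : A, algebraMap A T w ∉ M ∧ t * algebraMap A T w = algebraMap A T r := by
  let B := Localization.subalgebra.ofField (FractionRing A) M.primeCompl
    M.primeCompl_le_nonZeroDivisors
  have hloc : IsLocalization.AtPrime B M :=
    Localization.subalgebra.isLocalization_ofField _ _ _
  have hBlocal : IsLocalRing B := IsLocalization.AtPrime.isLocalRing B M
  obtain ⟨W, hW, hs⟩ := hA (B.restrictScalars A) hBlocal
    (fun P Q Qt => hT.of_isLocalization_atPrime M B P Q Qt)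
  obtain ⟨r, w, hw, h⟩ := hs (algebraMap T B t)
  refine ⟨w, r, fun hwM => ?_, ?_⟩
  · have hu : IsUnit (algebraMap T B (algebraMap A T w)) := hW w hw
    exact (IsLocalization.AtPrime.isUnit_to_map_iff B M _).1 hu hwM
  · have h' := congrArg Subtype.val h
    exact Subtype.ext h'

section Extension

variable {ι : Type*} [AddCommMonoid ι] {R : Type*} [CommRing R] [IsDomain R]

/-- The embedding of the fraction field of the degree-zero part into the fraction field. -/
noncomputable def zeroFracMap (𝒜 : ι → AddSubgroup R) :
    FractionRing (ZeroPart 𝒜) →+* FractionRing R :=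
  IsFractionRing.map (j := (ZeroPart 𝒜).subtype) Subtype.val_injective

theorem zeroFracMap_algebraMap (𝒜 : ι → AddSubgroup R) (a : ZeroPart 𝒜) :
    zeroFracMap 𝒜 (algebraMap _ _ a) = algebraMap R (FractionRing R) a :=
  IsLocalization.map_eq (S := FractionRing (ZeroPart 𝒜))
    (nonZeroDivisors_le_comap_nonZeroDivisors_of_injective (ZeroPart 𝒜).subtype
      Subtype.val_injective) a

/-- The overring of `R` generated by an overring of the degree-zero part. -/
noncomputable def extendedOverring (𝒜 : ι → AddSubgroup R)
    (T : Subalgebra (ZeroPart 𝒜) (FractionRing (ZeroPart 𝒜))) :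
    Subalgebra R (FractionRing R) :=
  Algebra.adjoin R (zeroFracMap 𝒜 '' T)

theorem zeroFracMap_mem_extendedOverring {𝒜 : ι → AddSubgroup R}
    {T : Subalgebra (ZeroPart 𝒜) (FractionRing (ZeroPart 𝒜))}
    {t : FractionRing (ZeroPart 𝒜)} (ht : t ∈ T) :
    zeroFracMap 𝒜 t ∈ extendedOverring 𝒜 T :=
  Algebra.subset_adjoin ⟨t, ht, rfl⟩

end Extension

section Grading

variable {ι : Type*} [DecidableEq ι] [AddCommMonoid ι] {R : Type*} [CommRing R]

/-- The projection onto the component of degree zero, as a ring homomorphism; the index monoid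
has no nontrivial units. -/
def zeroPartProj (𝒜 : ι → AddSubgroup R) [GradedRing 𝒜]
    (hU : ∀ a b : ι, a + b = 0 → a = 0) : R →+* ZeroPart 𝒜 where
  toFun r := ⟨DirectSum.decompose 𝒜 r 0, (mem_zeroPart_iff 𝒜).2 (SetLike.coe_mem _)⟩
  map_one' := Subtype.ext (DirectSum.decompose_of_mem_same 𝒜 SetLike.GradedOne.one_mem)
  map_zero' := Subtype.ext (by simp)
  map_add' x y := Subtype.ext (by simp)
  map_mul' x y := Subtype.ext <| by
    change (DirectSum.decompose 𝒜 (x * y) 0 : R)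
      = DirectSum.decompose 𝒜 x 0 * DirectSum.decompose 𝒜 y 0
    induction x using DirectSum.Decomposition.inductionOn 𝒜 with
    | zero => simp
    | add a b ha hb => 
      simp only [add_mul, DirectSum.decompose_add, DirectSum.add_apply, AddSubgroup.coe_add, ha, hb]
    | @homogeneous i a =>
      by_cases hi : i = 0
      · subst hi
        rw [DirectSum.coe_decompose_mul_of_left_mem_zero 𝒜 a.2,
          DirectSum.decompose_of_mem_same 𝒜 a.2]
      rw [DirectSum.decompose_of_mem_ne 𝒜 a.2 hi, zero_mul]
      induction y using DirectSum.Decomposition.inductionOn 𝒜 with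
      | zero => simp
      | add b c hb hc => 
        simp only [mul_add, DirectSum.decompose_add, DirectSum.add_apply, AddSubgroup.coe_add, hb,
          hc, add_zero]
      | @homogeneous j b =>
        exact DirectSum.decompose_of_mem_ne 𝒜 (SetLike.mul_mem_graded a.2 b.2)
          fun h => hi (hU i j h)

theorem zeroPartProj_coe (𝒜 : ι → AddSubgroup R) [GradedRing 𝒜]
    (hU : ∀ a b : ι, a + b = 0 → a = 0) (a : ZeroPart 𝒜) :
    zeroPartProj 𝒜 hU (a : R) = a :=
  Subtype.ext (DirectSum.decompose_of_mem_same 𝒜 ((mem_zeroPart_iff 𝒜).1 a.2))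

/-- The components of an element of a homogeneous ideal lie in the ideal. -/
theorem IsHomIdeal.decompose_mem {𝒜 : ι → AddSubgroup R} [GradedRing 𝒜] {I : Ideal R}
    (hI : IsHomIdeal 𝒜 I) {x : R} (hx : x ∈ I) (i : ι) :
    (DirectSum.decompose 𝒜 x i : R) ∈ I := by
  replace hx := hI x hx
  induction hx using AddSubmonoid.closure_induction with
  | mem y hy =>
    obtain ⟨⟨j, hj⟩, hyI⟩ := hy
    by_cases hji : j = i
    · subst hji
      rwa [DirectSum.decompose_of_mem_same 𝒜 hj]
    · rw [DirectSum.decompose_of_mem_ne 𝒜 hj hji]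
      exact I.zero_mem
  | zero => simp
  | add y z _ _ hy hz => simpa using I.add_mem hy hz

variable [IsDomain R]

theorem mem_closure_of_mem_extendedOverring {𝒜 : ι → AddSubgroup R} [GradedRing 𝒜]
    {T : Subalgebra (ZeroPart 𝒜) (FractionRing (ZeroPart 𝒜))} {x : FractionRing R}
    (hx : x ∈ extendedOverring 𝒜 T) :
    x ∈ AddSubmonoid.closure {y : FractionRing R | ∃ (i : ι) (r : R) (_ : r ∈ 𝒜 i),
      ∃ t ∈ T, y = algebraMap R (FractionRing R) r * zeroFracMap 𝒜 t} := by
  let N : Submonoid (FractionRing R) :=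
    { carrier := {y : FractionRing R | ∃ (i : ι) (r : R) (_ : r ∈ 𝒜 i),
        ∃ t ∈ T, y = algebraMap R (FractionRing R) r * zeroFracMap 𝒜 t}
      one_mem' := ⟨0, 1, SetLike.GradedOne.one_mem, 1, T.one_mem, by simp⟩
      mul_mem' := by
        rintro _ _ ⟨i, r, hr, t, ht, rfl⟩ ⟨j, s, hs, u, hu, rfl⟩
        refine ⟨i + j, r * s, SetLike.mul_mem_graded hr hs, t * u, T.mul_mem ht hu, ?_⟩
        rw [map_mul, map_mul]
        ring }
  change x ∈ AddSubmonoid.closure (N : Set (FractionRing R))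
  induction hx using Algebra.adjoin_induction with
  | mem y hy =>
    obtain ⟨t, ht, rfl⟩ := hy
    exact AddSubmonoid.subset_closure
      ⟨0, 1, SetLike.GradedOne.one_mem, t, ht, by simp⟩
  | algebraMap r =>
    induction r using DirectSum.Decomposition.inductionOn 𝒜 with
    | zero => simp
    | @homogeneous i a =>
      exact AddSubmonoid.subset_closure ⟨i, a, a.2, 1, T.one_mem, by simp⟩
    | add a b ha hb => simpa using add_mem ha hb
  | add y z _ _ hy hz => exact add_mem hy hz
  | mul y z _ _ hy hz => exact MulMemClass.mul_mem_add_closure hy hz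

/-- Denominators for `T` are also denominators for the overring generated by `T`, compatibly
with homogeneous components. -/
theorem exists_denominator_extendedOverring {𝒜 : ι → AddSubgroup R} [GradedRing 𝒜]
    (hU : ∀ a b : ι, a + b = 0 → a = 0)
    {T : Subalgebra (ZeroPart 𝒜) (FractionRing (ZeroPart 𝒜))}
    (N : Submonoid (ZeroPart 𝒜)) (hN0 : (0 : ZeroPart 𝒜) ∉ N)
    (hN : ∀ t ∈ T, ∃ w ∈ N, ∃ a : ZeroPart 𝒜,
      t * algebraMap _ (FractionRing (ZeroPart 𝒜)) w = algebraMap _ _ a)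
    {x : FractionRing R} (hx : x ∈ extendedOverring 𝒜 T) :
    ∃ w ∈ N, ∃ r : R,
      x * algebraMap R (FractionRing R) w = algebraMap R (FractionRing R) r ∧
      (∀ i, algebraMap R (FractionRing R) (DirectSum.decompose 𝒜 r i)
        / algebraMap R (FractionRing R) w ∈ extendedOverring 𝒜 T) ∧
      algebraMap _ (FractionRing (ZeroPart 𝒜)) (zeroPartProj 𝒜 hU r)
        / algebraMap _ (FractionRing (ZeroPart 𝒜)) w ∈ T := by
  have hne₀ {w : ZeroPart 𝒜} (hw : w ∈ N) :
      algebraMap _ (FractionRing (ZeroPart 𝒜)) w ≠ 0 := by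
    rw [ne_eq, FaithfulSMul.algebraMap_eq_zero_iff]
    rintro rfl
    exact hN0 hw
  have hne {w : ZeroPart 𝒜} (hw : w ∈ N) : algebraMap R (FractionRing R) w ≠ 0 := by
    rw [← zeroFracMap_algebraMap]
    exact (map_ne_zero _).2 (hne₀ hw)
  replace hx := mem_closure_of_mem_extendedOverring hx
  induction hx using AddSubmonoid.closure_induction with
  | mem y hy =>
    obtain ⟨i, r, hr, t, ht, rfl⟩ := hy
    obtain ⟨w, hw, a, h⟩ := hN t ht
    have h' : zeroFracMap 𝒜 t * algebraMap R (FractionRing R) w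
        = algebraMap R (FractionRing R) a := by
      rw [← zeroFracMap_algebraMap, ← zeroFracMap_algebraMap, ← h, map_mul]
    refine ⟨w, hw, a * r, ?_, fun j => ?_, ?_⟩
    · rw [map_mul, ← h']
      ring
    · rw [DirectSum.coe_decompose_mul_of_left_mem_zero 𝒜 ((mem_zeroPart_iff 𝒜).1 a.2), map_mul,
        ← h', mul_right_comm, mul_div_assoc, div_self (hne hw), mul_one]
      exact mul_mem (zeroFracMap_mem_extendedOverring ht) (Subalgebra.algebraMap_mem _ _)
    · rw [map_mul, zeroPartProj_coe, map_mul, ← h, mul_right_comm, mul_div_assoc,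
        div_self (hne₀ hw), mul_one]
      exact mul_mem ht (Subalgebra.algebraMap_mem _ _)
  | zero =>
    refine ⟨1, N.one_mem, 0, by simp, fun i => ?_, ?_⟩ <;> simp
  | add y z _ _ hy hz =>
    obtain ⟨u, hu, r, h₁, h₂, h₃⟩ := hy
    obtain ⟨v, hv, s, k₁, k₂, k₃⟩ := hz
    refine ⟨u * v, N.mul_mem hu hv, v * r + u * s, ?_, fun i => ?_, ?_⟩
    · simp only [Subring.coe_mul, map_mul, map_add, ← h₁, ← k₁]
      ring
    · convert add_mem (h₂ i) (k₂ i) using 1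
      have hu' := hne hu
      have hv' := hne hv
      simp only [DirectSum.decompose_add, DirectSum.add_apply, AddSubgroup.coe_add,
        DirectSum.coe_decompose_mul_of_left_mem_zero 𝒜 ((mem_zeroPart_iff 𝒜).1 u.2),
        DirectSum.coe_decompose_mul_of_left_mem_zero 𝒜 ((mem_zeroPart_iff 𝒜).1 v.2),
        Subring.coe_mul, map_mul, map_add]
      field_simp
    · convert add_mem h₃ k₃ using 1
      have hu' := hne₀ hu
      have hv' := hne₀ hv
      simp only [map_mul, map_add, zeroPartProj_coe]
      field_simp

theorem isHomFrac_decompose_div {𝒜 : ι → AddSubgroup R} [GradedRing 𝒜] (r : R) (i : ι)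
    {w : ZeroPart 𝒜} (hw : (w : R) ≠ 0) :
    IsHomFrac 𝒜 (algebraMap R (FractionRing R) (DirectSum.decompose 𝒜 r i)
      / algebraMap R (FractionRing R) w) :=
  ⟨i, 0, _, w, SetLike.coe_mem _, (mem_zeroPart_iff 𝒜).1 w.2, hw,
    div_mul_cancel₀ _ (by simpa using hw)⟩

open scoped Classical in
theorem eq_sum_decompose_div (𝒜 : ι → AddSubgroup R) [GradedRing 𝒜] {x : FractionRing R}
    {r w : R} (hw : w ≠ 0)
    (h : x * algebraMap R (FractionRing R) w = algebraMap R (FractionRing R) r) :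
    x = ∑ i ∈ (DirectSum.decompose 𝒜 r).support,
      algebraMap R (FractionRing R) (DirectSum.decompose 𝒜 r i)
        / algebraMap R (FractionRing R) w := by
  rw [← Finset.sum_div, ← map_sum, DirectSum.sum_support_decompose, ← h,
    mul_div_cancel_right₀ _ (by simpa using hw)]

theorem exists_nonzero_denominator {A : Type*} [CommRing A] [IsDomain A] (t : FractionRing A) :
    ∃ w ∈ nonZeroDivisors A, ∃ a : A,
      t * algebraMap A (FractionRing A) w = algebraMap A (FractionRing A) a := by
  obtain ⟨⟨a, w⟩, h⟩ := IsLocalization.surj (nonZeroDivisors A) t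
  exact ⟨w, w.2, a, h⟩

theorem isGradedOverring_extendedOverring (𝒜 : ι → AddSubgroup R) [GradedRing 𝒜]
    (hU : ∀ a b : ι, a + b = 0 → a = 0)
    (T : Subalgebra (ZeroPart 𝒜) (FractionRing (ZeroPart 𝒜))) :
    IsGradedOverring 𝒜 (extendedOverring 𝒜 T) := by
  intro x hx
  obtain ⟨w, hw, r, h, hr, -⟩ := exists_denominator_extendedOverring hU
    (nonZeroDivisors (ZeroPart 𝒜)) zero_notMem_nonZeroDivisors
    (fun t _ => exists_nonzero_denominator t) hx
  have hw' : (w : R) ≠ 0 := by simpa using nonZeroDivisors.ne_zero hw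
  rw [eq_sum_decompose_div 𝒜 hw' h]
  exact sum_mem fun i _ => AddSubmonoid.subset_closure ⟨hr i, isHomFrac_decompose_div r i hw'⟩

/-- The overring of `R` generated by a going-down overring of a perinormal degree-zero part
satisfies graded going-down. -/
theorem ggd_extendedOverring {𝒜 : ι → AddSubgroup R} [GradedRing 𝒜]
    (hU : ∀ a b : ι, a + b = 0 → a = 0) (hA : Perinormal (ZeroPart 𝒜))
    {T : Subalgebra (ZeroPart 𝒜) (FractionRing (ZeroPart 𝒜))} (hT : GoingDownOver T) :
    GGD 𝒜 (extendedOverring 𝒜 T) := by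
  intro P Q Qt hP hQ hQt hPh _ _ hPQ hc
  let ψ : T →+* extendedOverring 𝒜 T :=
    ((zeroFracMap 𝒜).comp T.val.toRingHom).codRestrict (extendedOverring 𝒜 T)
      fun t => zeroFracMap_mem_extendedOverring t.2
  have hψ (w : ZeroPart 𝒜) :
      ψ (algebraMap _ T w) = algebraMap R (extendedOverring 𝒜 T) w :=
    Subtype.ext (zeroFracMap_algebraMap 𝒜 w)
  have hQmem {r : R} : r ∈ Q ↔ algebraMap R (extendedOverring 𝒜 T) r ∈ Qt := by
    rw [← hc, Ideal.mem_comap]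
  let q := Q.comap (ZeroPart 𝒜).subtype
  have hden {x : FractionRing R} (hx : x ∈ extendedOverring 𝒜 T) :=
    exists_denominator_extendedOverring hU q.primeCompl (fun h => h q.zero_mem)
      (fun t ht => by
        obtain ⟨w, a, hw, h⟩ := hA.exists_denominator hT (Qt.comap ψ) ⟨t, ht⟩
        refine ⟨w, fun hwq => hw ?_, a, congrArg Subtype.val h⟩
        rw [Ideal.mem_comap, hψ]
        exact hQmem.1 hwq) hx
  have hcancel {w a r : R} (hw : w ∉ Q) (hr : r ∈ P)
      (h : algebraMap R (FractionRing R) a * algebraMap R (FractionRing R) w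
        = algebraMap R (FractionRing R) r) : a ∈ P := by
    rw [← map_mul, (IsFractionRing.injective R (FractionRing R)).eq_iff] at h
    exact (hP.mem_or_mem (h ▸ hr)).resolve_right fun h => hw (hPQ h)
  let Pt : Ideal (extendedOverring 𝒜 T) :=
    { carrier := {s | ∃ w : R, w ∉ Q ∧ ∃ r ∈ P,
        (s : FractionRing R) * algebraMap R (FractionRing R) w
          = algebraMap R (FractionRing R) r}
      zero_mem' := ⟨1, Q.ne_top_iff_one.1 hQ.ne_top, 0, P.zero_mem, by simp⟩
      add_mem' := by
        rintro x y ⟨u, hu, r, hr, h⟩ ⟨v, hv, s, hs, k⟩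
        refine ⟨u * v, fun huv => (hQ.mem_or_mem huv).elim hu hv, v * r + u * s,
          P.add_mem (P.mul_mem_left _ hr) (P.mul_mem_left _ hs), ?_⟩
        simp only [map_mul, map_add, ← h, ← k, Subalgebra.coe_add]
        ring
      smul_mem' := by
        rintro c x ⟨u, hu, r, hr, h⟩
        obtain ⟨v, hv, a, k, -⟩ := hden c.2
        refine ⟨u * v, fun huv => (hQ.mem_or_mem huv).elim hu hv, a * r,
          P.mul_mem_left _ hr, ?_⟩
        simp only [map_mul, ← h, ← k, smul_eq_mul, Subalgebra.coe_mul]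
        ring }
  refine ⟨Pt, ⟨?_, ?_⟩, ?_, ?_, ?_⟩
  · rw [Ideal.ne_top_iff_one]
    rintro ⟨w, hw, r, hr, h⟩
    exact hP.ne_top (P.eq_top_iff_one.2 (hcancel hw hr (by simpa using h)))
  · rintro x y ⟨w, hw, r, hr, h⟩
    obtain ⟨u, hu, a, ha, -⟩ := hden x.2
    obtain ⟨v, hv, b, hb, -⟩ := hden y.2
    have hab : a * b ∈ P := by
      refine hcancel hw (P.mul_mem_left (u * v) hr) ?_
      simp only [map_mul, ← h, ← ha, ← hb, Subalgebra.coe_mul]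
      ring
    exact (hP.mem_or_mem hab).imp (fun h => ⟨u, hu, a, h, ha⟩) (fun h => ⟨v, hv, b, h, hb⟩)
  · rintro x ⟨u, hu, p, hp, h⟩
    obtain ⟨w, hw, r, k, hr, -⟩ := hden x.2
    have hw' : (w : R) ≠ 0 := fun h => hw (by
      change (w : R) ∈ Q
      exact h ▸ Q.zero_mem)
    have hrP : r ∈ P := by
      refine hcancel hu (P.mul_mem_left w hp) ?_
      rw [map_mul, ← h, ← k]
      ring
    rw [eq_sum_decompose_div 𝒜 hw' k]
    exact sum_mem fun i _ => AddSubmonoid.subset_closure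
      ⟨isHomFrac_decompose_div r i hw', hr i, w, hw, _, hPh.decompose_mem hrP i,
        div_mul_cancel₀ _ (by simpa using hw')⟩
  · rintro x ⟨w, hw, r, hr, h⟩
    have h' : x * algebraMap R (extendedOverring 𝒜 T) w = algebraMap R _ r := Subtype.ext h
    exact (hQt.mem_or_mem (h' ▸ hQmem.1 (hPQ hr))).resolve_right fun k => hw (hQmem.2 k)
  · ext r
    exact ⟨fun ⟨w, hw, a, ha, h⟩ => hcancel hw ha h,
      fun hr => ⟨1, Q.ne_top_iff_one.1 hQ.ne_top, r, hr, by
        rw [map_one, mul_one]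
        rfl⟩⟩

/-- If the overring of `R` generated by `T` is a localization of `R`, then `T` is a localization
of the degree-zero part. -/
theorem IsLocalizationOfR.of_extendedOverring {𝒜 : ι → AddSubgroup R} [GradedRing 𝒜]
    (hU : ∀ a b : ι, a + b = 0 → a = 0)
    {T : Subalgebra (ZeroPart 𝒜) (FractionRing (ZeroPart 𝒜))}
    (hS : IsLocalizationOfR (extendedOverring 𝒜 T)) : IsLocalizationOfR T := by
  obtain ⟨W, hW, hs⟩ := hS
  have hinj := IsFractionRing.injective R (FractionRing R)
  have hproj {a b : ZeroPart 𝒜} {x y : R} (h : (a : R) * x = b * y) :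
      a * zeroPartProj 𝒜 hU x = b * zeroPartProj 𝒜 hU y := by
    simpa only [map_mul, zeroPartProj_coe] using congrArg (zeroPartProj 𝒜 hU) h
  refine ⟨W.map (zeroPartProj 𝒜 hU), ?_, fun t => ?_⟩
  · rintro _ ⟨w, hw, rfl⟩
    obtain ⟨v, hv⟩ := (hW w hw).exists_right_inv
    obtain ⟨d, hd, r, h, -, hr⟩ := exists_denominator_extendedOverring hU
      (nonZeroDivisors (ZeroPart 𝒜)) zero_notMem_nonZeroDivisors
      (fun t _ => exists_nonzero_denominator t) v.2
    have hv' : algebraMap R (FractionRing R) w * v = 1 := congrArg Subtype.val hv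
    have hrw : r * w = d := hinj <| by
      rw [map_mul, ← h]
      linear_combination algebraMap R (FractionRing R) d * hv'
    have hrw' : zeroPartProj 𝒜 hU r * zeroPartProj 𝒜 hU w = d := by
      rw [← map_mul, hrw, zeroPartProj_coe]
    refine IsUnit.of_mul_eq_one ⟨_, hr⟩ (Subtype.ext ?_)
    change algebraMap _ (FractionRing (ZeroPart 𝒜)) (zeroPartProj 𝒜 hU w) * (_ / _) = 1
    rw [mul_div_assoc', mul_comm, ← map_mul, hrw', div_self]
    simpa using nonZeroDivisors.ne_zero hd
  · obtain ⟨r, w, hw, h⟩ := hs ⟨_, zeroFracMap_mem_extendedOverring t.2⟩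
    obtain ⟨b, hb, a, hab⟩ := exists_nonzero_denominator (t : FractionRing (ZeroPart 𝒜))
    refine ⟨zeroPartProj 𝒜 hU r, zeroPartProj 𝒜 hU w, ⟨w, hw, rfl⟩, Subtype.ext ?_⟩
    have h' : zeroFracMap 𝒜 t * algebraMap R (FractionRing R) w
        = algebraMap R (FractionRing R) r := congrArg Subtype.val h
    have hab' : zeroFracMap 𝒜 t * algebraMap R (FractionRing R) b
        = algebraMap R (FractionRing R) a := by
      rw [← zeroFracMap_algebraMap, ← zeroFracMap_algebraMap, ← hab, map_mul]
    have key : (a : R) * w = b * r := hinj <| by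
      rw [map_mul, map_mul, ← h', ← hab']
      ring
    have key' := congrArg (algebraMap _ (FractionRing (ZeroPart 𝒜))) (hproj key)
    rw [map_mul, map_mul, ← hab] at key'
    have hb' : algebraMap _ (FractionRing (ZeroPart 𝒜)) b ≠ 0 := by
      simpa using nonZeroDivisors.ne_zero hb
    refine mul_left_cancel₀ hb' ?_
    change _ * ((t : FractionRing (ZeroPart 𝒜)) * algebraMap _ _ _) = _ * algebraMap _ _ _
    rw [← key']
    ring

end Grading

set_option synthInstance.maxHeartbeats 1000000 in
set_option maxHeartbeats 1600000 in
/-- Let `Γ` be a torsion-free commutative cancellative monoid with trivial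
group of units and `R` a `Γ`-graded domain with 0th graded component `R₀`. If `R` is a graded
globally perinormal domain and `R₀` is perinormal, then `R₀` is globally perinormal. -/
theorem globallyPerinormal_zeroPart
    {Γ : Type*} [DecidableEq Γ] [AddCancelCommMonoid Γ]
    (hTF : ∀ (k : ℕ) (a b : Γ), k ≠ 0 → k • a = k • b → a = b)
    (hU : ∀ a b : Γ, a + b = 0 → a = 0)
    {R : Type*} [CommRing R] [IsDomain R]
    (𝒜 : Γ → AddSubgroup R) (hGr : IsGrRing 𝒜)
    (hR : GradedGloballyPerinormal 𝒜)
    (hR0 : Perinormal (ZeroPart 𝒜)) :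
    GloballyPerinormal (ZeroPart 𝒜) := by
  let _ : GradedRing 𝒜 :=
    { hGr.internal.chooseDecomposition with
      one_mem := hGr.one_mem
      mul_mem := fun _ _ _ _ ha hb => hGr.mul_mem ha hb }
  exact fun T hT => IsLocalizationOfR.of_extendedOverring hU
    (hR _ (isGradedOverring_extendedOverring 𝒜 hU T) (ggd_extendedOverring hU hR0 hT))
end

section
/- Let A be a G-graded domain and give the polynomial ring A[X] the natural (G × ℤ_{≥0})-grading in which a monomial aX^n with a ∈ A_g is homogeneous of degree (g, n). If A[X] is a graded perinormal domain, then A is a graded perinormal domain. -/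
/-- The natural `G × ℤ` grading (supported on `G × ℤ≥0`) on the polynomial ring over a
`G`-graded ring: `a • Xⁿ` with `a ∈ A_g` is homogeneous of degree `(g, n)`. -/
def polyGrading {G : Type*} {A : Type*} [CommRing A] (𝒜 : G → AddSubgroup A) :
    G × ℤ → AddSubgroup (Polynomial A) := fun gn =>
  { carrier := {p | p = 0 ∨ ∃ (a : A) (n : ℕ), a ∈ 𝒜 gn.1 ∧ (n : ℤ) = gn.2 ∧
      p = Polynomial.C a * Polynomial.X ^ n}
    zero_mem' := Or.inl rfl
    add_mem' := by
      rintro p q (rfl | ⟨a, n, ha, hn, rfl⟩) hq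
      · simpa using hq
      · rcases hq with rfl | ⟨b, m, hb, hm, rfl⟩
        · exact Or.inr ⟨a, n, ha, hn, by simp⟩
        · obtain rfl : n = m := by exact_mod_cast hn.trans hm.symm
          exact Or.inr ⟨a + b, n, (𝒜 gn.1).add_mem ha hb, hn, by rw [map_add, add_mul]⟩
    neg_mem' := by
      rintro p (rfl | ⟨a, n, ha, hn, rfl⟩)
      · exact Or.inl neg_zero
      · exact Or.inr ⟨-a, n, (𝒜 gn.1).neg_mem ha, hn, by rw [map_neg, neg_mul]⟩ }

section LaurentExtension

open LaurentPolynomial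

theorem isHomIdealOver_iff {ι R : Type*} [CommRing R] [IsDomain R]
    {𝒜 : ι → AddSubgroup R} {S : Subalgebra R (FractionRing R)} {I : Ideal S} :
    IsHomIdealOver 𝒜 S I ↔
      ∀ x ∈ I, x ∈ AddSubmonoid.closure {s : S | IsHomFrac 𝒜 (s : FractionRing R) ∧ s ∈ I} := by
  have hset : {y : FractionRing R | IsHomFrac 𝒜 y ∧ ∃ h : y ∈ S, (⟨y, h⟩ : S) ∈ I} =
      S.val.toRingHom.toAddMonoidHom ''
        {s : S | IsHomFrac 𝒜 (s : FractionRing R) ∧ s ∈ I} := by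
    ext y
    constructor
    · rintro ⟨hy, h, hI⟩
      exact ⟨⟨y, h⟩, ⟨hy, hI⟩, rfl⟩
    · rintro ⟨s, ⟨hs, hI⟩, rfl⟩
      exact ⟨hs, s.2, hI⟩
  unfold IsHomIdealOver
  rw [hset, ← AddMonoidHom.map_mclosure]
  refine forall₂_congr fun x _ => ?_
  constructor
  · rintro ⟨s, hs, hsx⟩
    obtain rfl : s = x := Subtype.ext hsx
    exact hs
  · exact fun hx => ⟨x, hx, rfl⟩

theorem isGradedOverring_iff {ι R : Type*} [CommRing R] [IsDomain R]
    {𝒜 : ι → AddSubgroup R} {S : Subalgebra R (FractionRing R)} :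
    IsGradedOverring 𝒜 S ↔ IsHomIdealOver 𝒜 S ⊤ := by
  have hset : {y : FractionRing R | y ∈ S ∧ IsHomFrac 𝒜 y} =
      {y : FractionRing R | IsHomFrac 𝒜 y ∧ ∃ h : y ∈ S, (⟨y, h⟩ : S) ∈ (⊤ : Ideal S)} := by
    ext y
    simp [and_comm]
  unfold IsGradedOverring IsHomIdealOver
  rw [hset]
  exact ⟨fun h x _ => h x x.2, fun h x hx => h ⟨x, hx⟩ trivial⟩

/-- An additive property of Laurent polynomials that holds for each term holds for the sum. -/
theorem LaurentPolynomial.mem_of_forall_term_mem {R : Type*} [Semiring R]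
    (M : AddSubmonoid R[T;T⁻¹]) (f : R[T;T⁻¹]) (h : ∀ n, C (f.coeff n) * T n ∈ M) : f ∈ M := by
  have hf : f = ∑ n ∈ f.coeff.support, C (f.coeff n) * T n := by
    ext m
    simp [← single_eq_C_mul_T, Finsupp.single_apply]
  rw [hf]
  exact sum_mem fun n _ => h n

theorem LaurentPolynomial.mapRingHom_C_mul_T {R R' : Type*} [Semiring R] [Semiring R']
    (φ : R →+* R') (r : R) (n : ℤ) :
    AddMonoidAlgebra.mapRingHom ℤ φ (C r * T n) = C (φ r) * T n := by
  ext m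
  rw [AddMonoidAlgebra.coeff_mapRingHom, ← single_eq_C_mul_T, ← single_eq_C_mul_T,
    AddMonoidAlgebra.coeff_single, AddMonoidAlgebra.coeff_single, Finsupp.single_apply,
    Finsupp.single_apply]
  split_ifs <;> simp

theorem LaurentPolynomial.forall_coeff_toLaurent_mem {R : Type*} [CommRing R] {I : Ideal R}
    {p : Polynomial R} :
    (∀ n, (Polynomial.toLaurent p).coeff n ∈ I) ↔ ∀ n, p.coeff n ∈ I := by
  have hcast (n : ℕ) : (Polynomial.toLaurent p).coeff (n : ℤ) = p.coeff n :=
    Finsupp.mapDomain_apply Nat.cast_injective _ n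
  refine ⟨fun h n => hcast n ▸ h n, fun h n => ?_⟩
  by_cases hn : n ∈ Set.range (Nat.cast : ℕ → ℤ)
  · obtain ⟨k, rfl⟩ := hn
    exact hcast k ▸ h k
  · rw [show (Polynomial.toLaurent p).coeff n = 0 from Finsupp.mapDomain_of_notMem_range _ n hn]
    exact I.zero_mem

/-- A homogeneous prime of `A[X]` not containing `X` is the extension of its contraction,
which is homogeneous. -/
theorem IsHomIdeal.comap_C {G A : Type*} [CommRing A] {𝒜 : G → AddSubgroup A}
    {P : Ideal (Polynomial A)} [P.IsPrime]
    (hP : IsHomIdeal (polyGrading 𝒜) P) (hX : Polynomial.X ∉ P) :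
    IsHomIdeal 𝒜 (P.comap Polynomial.C) ∧ (P.comap Polynomial.C).map Polynomial.C = P := by
  have hterm {a : A} {n : ℕ} (h : Polynomial.C a * Polynomial.X ^ n ∈ P) :
      Polynomial.C a ∈ P :=
    (‹P.IsPrime›.mem_or_mem h).resolve_right fun h => hX (‹P.IsPrime›.mem_of_pow_mem _ h)
  constructor
  · intro x hx
    have hx' : x = Polynomial.eval 1 (Polynomial.C x) := by simp
    rw [hx']
    replace hx := hP _ hx
    generalize Polynomial.C x = f at hx
    induction hx using AddSubmonoid.closure_induction with
    | mem y hy =>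
      obtain ⟨⟨i, rfl | ⟨a, n, ha, -, rfl⟩⟩, hyP⟩ := hy
      · simp
      · refine AddSubmonoid.subset_closure ⟨⟨i.1, by simpa using ha⟩, ?_⟩
        simpa using hterm hyP
    | zero => simp
    | add y z _ _ hy hz =>
      rw [Polynomial.eval_add]
      exact add_mem hy hz
  · refine le_antisymm Ideal.map_comap_le fun x hx => ?_
    refine (AddSubmonoid.closure_le
      (S := ((P.comap Polynomial.C).map Polynomial.C).toAddSubmonoid)).mpr ?_ (hP x hx)
    rintro y ⟨⟨i, rfl | ⟨a, n, -, -, rfl⟩⟩, hyP⟩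
    · exact zero_mem _
    · exact Ideal.mul_mem_right _ _ (Ideal.mem_map_of_mem _ (hterm hyP))

variable {G A : Type*} [CommRing A] [IsDomain A]

/-- The embedding of the quotient field of `A` into that of `A[X]`. -/
noncomputable def fracC : FractionRing A →+* FractionRing (Polynomial A) :=
  IsLocalization.map (M := nonZeroDivisors A) (T := nonZeroDivisors (Polynomial A)) _ Polynomial.C
    (nonZeroDivisors_le_comap_nonZeroDivisors_of_injective _ Polynomial.C_injective)

theorem fracC_algebraMap (a : A) :
    fracC (algebraMap A (FractionRing A) a) =
      algebraMap (Polynomial A) (FractionRing (Polynomial A)) (Polynomial.C a) :=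
  IsLocalization.map_eq _ a

/-- The indeterminate as a unit of the quotient field of `A[X]`. -/
noncomputable def fracX (A : Type*) [CommRing A] [IsDomain A] :
    (FractionRing (Polynomial A))ˣ :=
  Units.mk0 (algebraMap (Polynomial A) _ Polynomial.X) (by simp)

/-- Laurent polynomials over the quotient field of `A`, as fractions of polynomials. -/
noncomputable def laurentFrac :
    (FractionRing A)[T;T⁻¹] →+* FractionRing (Polynomial A) :=
  LaurentPolynomial.eval₂ fracC (fracX A)

theorem laurentFrac_toLaurent_map (p : Polynomial A) :
    laurentFrac (Polynomial.toLaurent (p.map (algebraMap A (FractionRing A)))) =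
      algebraMap (Polynomial A) (FractionRing (Polynomial A)) p := by
  rw [laurentFrac, eval₂_toLaurent, Polynomial.eval₂_map]
  induction p using Polynomial.induction_on' with
  | add p q hp hq => rw [Polynomial.eval₂_add, hp, hq, map_add]
  | monomial n a =>
    rw [Polynomial.eval₂_monomial, RingHom.comp_apply, fracC_algebraMap,
      ← Polynomial.C_mul_X_pow_eq_monomial, map_mul, map_pow]
    rfl

theorem laurentFrac_injective : Function.Injective (laurentFrac (A := A)) := by
  rw [injective_iff_map_eq_zero]
  intro f hf
  obtain ⟨n, g, hg⟩ := exists_T_pow f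
  obtain ⟨b, hb0, hb⟩ := IsLocalization.integerNormalization_spec (nonZeroDivisors A) g
  have hp : IsLocalization.integerNormalization (nonZeroDivisors A) g = 0 := by
    apply IsFractionRing.injective (Polynomial A) (FractionRing (Polynomial A))
    rw [map_zero, ← laurentFrac_toLaurent_map, hb, Algebra.smul_def, map_mul, map_mul, hg,
      map_mul, hf, zero_mul, mul_zero]
  rw [hp, Polynomial.map_zero, eq_comm, Algebra.smul_def, IsScalarTower.algebraMap_apply A
    (FractionRing A) (Polynomial (FractionRing A)), mul_eq_zero] at hb
  rcases hb with hb | hb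
  · exact absurd hb (by simpa using nonZeroDivisors.ne_zero hb0)
  · rw [hb, map_zero, eq_comm] at hg
    exact ((isUnit_T (n : ℤ)).mul_left_eq_zero).mp hg

/-- Laurent polynomials over an overring of `A`, as fractions of polynomials. -/
noncomputable def laurentIncl (S : Subalgebra A (FractionRing A)) :
    S[T;T⁻¹] →+* FractionRing (Polynomial A) :=
  laurentFrac.comp (AddMonoidAlgebra.mapRingHom ℤ (S.val : S →+* FractionRing A))

theorem laurentIncl_injective (S : Subalgebra A (FractionRing A)) :
    Function.Injective (laurentIncl S) := by
  refine laurentFrac_injective.comp fun f g hfg => ?_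
  ext n
  have := congrArg (fun h => AddMonoidAlgebra.coeff h n) hfg
  simpa using this

theorem laurentIncl_C_mul_T (S : Subalgebra A (FractionRing A)) (s : S) (n : ℤ) :
    laurentIncl S (C s * T n) = fracC (s : FractionRing A) * ((fracX A ^ n : _ˣ) : _) := by
  rw [laurentIncl, RingHom.comp_apply, mapRingHom_C_mul_T, laurentFrac, eval₂_C_mul_T]
  rfl

theorem laurentIncl_toLaurent_map (S : Subalgebra A (FractionRing A)) (p : Polynomial A) :
    laurentIncl S (Polynomial.toLaurent (p.map (algebraMap A S))) =
      algebraMap (Polynomial A) (FractionRing (Polynomial A)) p := by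
  rw [← laurentFrac_toLaurent_map, laurentIncl, RingHom.comp_apply]
  congr 1
  induction p using Polynomial.induction_on' with
  | add p q hp hq => simp only [Polynomial.map_add, map_add, hp, hq]
  | monomial n a =>
    simp only [Polynomial.map_monomial, Polynomial.toLaurent_C_mul_T, mapRingHom_C_mul_T]
    rfl

/-- The overring `S[X, X⁻¹]` of `A[X]` attached to an overring `S` of `A`. -/
noncomputable def laurentOver (S : Subalgebra A (FractionRing A)) :
    Subalgebra (Polynomial A) (FractionRing (Polynomial A)) :=
  { (laurentIncl S).rangeS with
    algebraMap_mem' := fun p => ⟨_, laurentIncl_toLaurent_map S p⟩ }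

/-- `S[X, X⁻¹]` is the ring of Laurent polynomials over `S`. -/
noncomputable def laurentEquiv (S : Subalgebra A (FractionRing A)) :
    S[T;T⁻¹] ≃+* laurentOver S :=
  RingEquiv.ofBijective
    ((laurentIncl S).codRestrict (laurentOver S) fun f => (⟨f, rfl⟩ : _ ∈ (laurentIncl S).rangeS))
    ⟨fun _ _ h => laurentIncl_injective S (congrArg Subtype.val h),
      fun ⟨_, f, hf⟩ => ⟨f, Subtype.ext hf⟩⟩

variable {S : Subalgebra A (FractionRing A)}

theorem coe_laurentEquiv (f : S[T;T⁻¹]) :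
    (laurentEquiv S f : FractionRing (Polynomial A)) = laurentIncl S f := rfl

theorem algebraMap_laurentOver (p : Polynomial A) :
    algebraMap (Polynomial A) (laurentOver S) p =
      laurentEquiv S (Polynomial.toLaurent (p.map (algebraMap A S))) :=
  Subtype.ext (laurentIncl_toLaurent_map S p).symm

/-- The evaluation `S[X, X⁻¹] → S` at `X = 1`. -/
noncomputable def laurentEvalOne (S : Subalgebra A (FractionRing A)) : laurentOver S →+* S :=
  (LaurentPolynomial.eval₂ (RingHom.id S) 1).comp
    ((laurentEquiv S).symm : laurentOver S →+* S[T;T⁻¹])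

theorem laurentEvalOne_C_mul_T (s : S) (n : ℤ) :
    laurentEvalOne S (laurentEquiv S (C s * T n)) = s := by
  rw [laurentEvalOne, RingHom.comp_apply, RingHom.coe_coe, RingEquiv.symm_apply_apply,
    eval₂_C_mul_T, one_zpow, Units.val_one, mul_one, RingHom.id_apply]

theorem laurentEvalOne_C (s : S) : laurentEvalOne S (laurentEquiv S (C s)) = s := by
  simpa only [T_zero, mul_one] using laurentEvalOne_C_mul_T s 0

theorem laurentEvalOne_algebraMap (p : Polynomial A) :
    laurentEvalOne S (algebraMap _ _ p) = algebraMap A S (Polynomial.evalRingHom 1 p) := by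
  rw [algebraMap_laurentOver, laurentEvalOne, RingHom.comp_apply, RingHom.coe_coe,
    RingEquiv.symm_apply_apply, eval₂_toLaurent, Polynomial.eval₂_map, Units.val_one,
    RingHom.id_comp, Polynomial.coe_evalRingHom, Polynomial.eval, Polynomial.hom_eval₂,
    map_one, RingHom.comp_id]

/-- The extension of an ideal of `S` to `S[X, X⁻¹]`. -/
noncomputable def laurentExtend (I : Ideal S) : Ideal (laurentOver S) :=
  (RingHom.ker (AddMonoidAlgebra.mapRingHom ℤ (Ideal.Quotient.mk I))).comap
    (laurentEquiv S).symm

/-- The contraction of an ideal of `S[X, X⁻¹]` to `S`. -/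
noncomputable def laurentContract (J : Ideal (laurentOver S)) : Ideal S :=
  J.comap ((laurentEquiv S : S[T;T⁻¹] →+* laurentOver S).comp C)

theorem laurentEquiv_mem_laurentExtend {I : Ideal S} {f : S[T;T⁻¹]} :
    laurentEquiv S f ∈ laurentExtend I ↔ ∀ n, f.coeff n ∈ I := by
  simp only [laurentExtend, Ideal.mem_comap, RingEquiv.symm_apply_apply, RingHom.mem_ker,
    LaurentPolynomial.ext_iff, AddMonoidAlgebra.coeff_mapRingHom, AddMonoidAlgebra.coeff_zero,
    Finsupp.coe_zero, Pi.zero_apply, Ideal.Quotient.eq_zero_iff_mem]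

theorem mem_laurentContract {J : Ideal (laurentOver S)} {s : S} :
    s ∈ laurentContract J ↔ laurentEquiv S (C s) ∈ J := Iff.rfl

theorem laurentEquiv_C_mul_T_mem {J : Ideal (laurentOver S)} {s : S} {n : ℤ} :
    laurentEquiv S (C s * T n) ∈ J ↔ s ∈ laurentContract J := by
  rw [map_mul, mem_laurentContract]
  exact Ideal.mul_unit_mem_iff_mem J ((isUnit_T n).map (laurentEquiv S))

theorem laurentExtend_isPrime (I : Ideal S) [I.IsPrime] : (laurentExtend I).IsPrime := by
  have : (RingHom.ker (AddMonoidAlgebra.mapRingHom ℤ (Ideal.Quotient.mk I))).IsPrime :=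
    RingHom.ker_isPrime _
  exact Ideal.comap_isPrime _ _

theorem laurentContract_isPrime (J : Ideal (laurentOver S)) [J.IsPrime] :
    (laurentContract J).IsPrime :=
  Ideal.comap_isPrime _ _

theorem laurentExtend_mono {I J : Ideal S} (h : I ≤ J) : laurentExtend I ≤ laurentExtend J := by
  intro x hx
  obtain ⟨f, rfl⟩ := (laurentEquiv S).surjective x
  rw [laurentEquiv_mem_laurentExtend] at hx ⊢
  exact fun n => h (hx n)

theorem laurentContract_mono {I J : Ideal (laurentOver S)} (h : I ≤ J) :
    laurentContract I ≤ laurentContract J :=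
  Ideal.comap_mono h

theorem laurentContract_laurentExtend (I : Ideal S) : laurentContract (laurentExtend I) = I := by
  ext s
  rw [mem_laurentContract, laurentEquiv_mem_laurentExtend]
  constructor
  · intro h
    simpa using h 0
  · intro h n
    rw [C_apply]
    split_ifs
    exacts [h, I.zero_mem]

theorem laurentContract_ne_top {J : Ideal (laurentOver S)} (h : J ≠ ⊤) :
    laurentContract J ≠ ⊤ :=
  Ideal.comap_ne_top _ h

theorem laurentExtend_ne_top {I : Ideal S} (h : I ≠ ⊤) : laurentExtend I ≠ ⊤ := by
  intro htop
  apply h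
  rw [← laurentContract_laurentExtend I, htop]
  exact Ideal.comap_top

theorem laurentExtend_laurentContract_le (J : Ideal (laurentOver S)) :
    laurentExtend (laurentContract J) ≤ J := by
  intro x hx
  obtain ⟨f, rfl⟩ := (laurentEquiv S).surjective x
  rw [laurentEquiv_mem_laurentExtend] at hx
  exact mem_of_forall_term_mem (J.toAddSubmonoid.comap (laurentEquiv S)) f
    fun n => laurentEquiv_C_mul_T_mem.mpr (hx n)

variable {𝒜 : G → AddSubgroup A}

theorem IsHomFrac.laurentEquiv_C_mul_T {s : S} (hs : IsHomFrac 𝒜 (s : FractionRing A)) (n : ℤ) :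
    IsHomFrac (polyGrading 𝒜)
      (laurentEquiv S (C s * T n) : FractionRing (Polynomial A)) := by
  obtain ⟨i, j, a, b, ha, hb, hb0, hab⟩ := hs
  refine ⟨(i, (n.toNat : ℤ)), (j, ((-n).toNat : ℤ)), Polynomial.C a * Polynomial.X ^ n.toNat,
    Polynomial.C b * Polynomial.X ^ (-n).toNat, Or.inr ⟨a, _, ha, rfl, rfl⟩,
    Or.inr ⟨b, _, hb, rfl, rfl⟩, by simpa using hb0, ?_⟩
  have hX : ((fracX A ^ n : _ˣ) : FractionRing (Polynomial A)) *
      algebraMap _ _ (Polynomial.X : Polynomial A) ^ (-n).toNat =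
      algebraMap _ _ (Polynomial.X : Polynomial A) ^ n.toNat := by
    have : fracX A ^ n * fracX A ^ (-n).toNat = fracX A ^ n.toNat := by
      rw [← zpow_natCast, ← zpow_natCast, ← zpow_add]
      congr 1
      omega
    simpa [fracX] using congrArg Units.val this
  rw [coe_laurentEquiv, laurentIncl_C_mul_T, map_mul, map_mul, map_pow, map_pow,
    ← fracC_algebraMap, ← fracC_algebraMap, ← hX, ← hab, map_mul]
  ring

theorem exists_laurentEquiv_eq_of_isHomFrac {y : laurentOver S}
    (hy : IsHomFrac (polyGrading 𝒜) (y : FractionRing (Polynomial A))) :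
    ∃ (s : S) (n : ℤ), IsHomFrac 𝒜 (s : FractionRing A) ∧ laurentEquiv S (C s * T n) = y := by
  obtain ⟨i, j, p, q, hp, rfl | ⟨b, m, hb, -, rfl⟩, hq0, hpq⟩ := hy
  · exact absurd rfl hq0
  obtain ⟨a, k, ha, rfl⟩ : ∃ (a : A) (k : ℕ), a ∈ 𝒜 i.1 ∧
      p = Polynomial.C a * Polynomial.X ^ k := by
    obtain rfl | ⟨a, k, ha, -, rfl⟩ := hp
    · exact ⟨0, 0, zero_mem _, by simp⟩
    · exact ⟨a, k, ha, rfl⟩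
  have hb0 : b ≠ 0 := by
    rintro rfl
    simp at hq0
  obtain ⟨f, rfl⟩ := (laurentEquiv S).surjective y
  rw [coe_laurentEquiv, ← laurentIncl_toLaurent_map S, ← laurentIncl_toLaurent_map S,
    ← map_mul] at hpq
  have hf := laurentIncl_injective S hpq
  simp only [Polynomial.map_mul, Polynomial.map_C, Polynomial.map_pow, Polynomial.map_X,
    Polynomial.toLaurent_C_mul_X_pow] at hf
  replace hf : f * C (algebraMap A S b) = C (algebraMap A S a) * T (k - m) := by
    rw [T_sub, ← mul_assoc, ← hf, mul_assoc, mul_assoc, ← T_add, add_neg_cancel, T_zero, mul_one]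
  have hcoeff (n : ℤ) : f.coeff n * algebraMap A S b =
      if (k - m : ℤ) = n then algebraMap A S a else 0 := by
    rw [← single_eq_C_mul_T, ← single_eq_C] at hf
    rw [← AddMonoidAlgebra.coeff_mul_single_zero, hf, AddMonoidAlgebra.coeff_single,
      Finsupp.single_apply]
  have hbS : algebraMap A S b ≠ 0 := by
    simpa using hb0
  refine ⟨f.coeff (k - m), k - m, ⟨i.1, j.1, a, b, ha, hb, hb0, ?_⟩, ?_⟩
  · simpa using congrArg Subtype.val (hcoeff (k - m))
  · congr 1
    ext n : 1
    rw [← single_eq_C_mul_T, AddMonoidAlgebra.coeff_single, Finsupp.single_apply]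
    split_ifs with h
    · rw [h]
    · have := hcoeff n
      rw [if_neg h] at this
      exact ((mul_eq_zero.mp this).resolve_right hbS).symm

theorem IsHomIdealOver.laurentExtend {I : Ideal S} (hI : IsHomIdealOver 𝒜 S I) :
    IsHomIdealOver (polyGrading 𝒜) (laurentOver S) (laurentExtend I) := by
  rw [isHomIdealOver_iff] at hI ⊢
  intro x hx
  obtain ⟨f, rfl⟩ := (laurentEquiv S).surjective x
  rw [laurentEquiv_mem_laurentExtend] at hx
  refine mem_of_forall_term_mem (AddSubmonoid.comap (laurentEquiv S)
    (AddSubmonoid.closure _)) f fun n => ?_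
  rw [AddSubmonoid.mem_comap]
  have hfn := hI _ (hx n)
  generalize f.coeff n = s at hfn
  induction hfn using AddSubmonoid.closure_induction with
  | mem s hs =>
    refine AddSubmonoid.subset_closure ⟨hs.1.laurentEquiv_C_mul_T n, ?_⟩
    rw [laurentEquiv_C_mul_T_mem, laurentContract_laurentExtend]
    exact hs.2
  | zero => simp
  | add s t _ _ hs ht =>
    rw [map_add, add_mul, map_add]
    exact add_mem hs ht

theorem IsHomIdealOver.laurentContract {J : Ideal (laurentOver S)}
    (hJ : IsHomIdealOver (polyGrading 𝒜) (laurentOver S) J) :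
    IsHomIdealOver 𝒜 S (laurentContract J) := by
  rw [isHomIdealOver_iff] at hJ ⊢
  intro x hx
  rw [mem_laurentContract] at hx
  rw [← laurentEvalOne_C x]
  replace hx := hJ _ hx
  generalize laurentEquiv S (C x) = y at hx
  induction hx using AddSubmonoid.closure_induction with
  | mem y hy =>
    obtain ⟨s, n, hs, rfl⟩ := exists_laurentEquiv_eq_of_isHomFrac hy.1
    rw [laurentEvalOne_C_mul_T]
    exact AddSubmonoid.subset_closure ⟨hs, laurentEquiv_C_mul_T_mem.mp hy.2⟩
  | zero => simp
  | add y z _ _ hy hz =>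
    rw [map_add]
    exact add_mem hy hz

theorem IsHomIdealOver.laurentExtend_laurentContract {J : Ideal (laurentOver S)}
    (hJ : IsHomIdealOver (polyGrading 𝒜) (laurentOver S) J) :
    _root_.laurentExtend (_root_.laurentContract J) = J := by
  refine le_antisymm (laurentExtend_laurentContract_le J) fun x hx => ?_
  replace hx := isHomIdealOver_iff.mp hJ x hx
  induction hx using AddSubmonoid.closure_induction with
  | mem y hy =>
    obtain ⟨s, n, -, rfl⟩ := exists_laurentEquiv_eq_of_isHomFrac hy.1
    rw [laurentEquiv_C_mul_T_mem, laurentContract_laurentExtend]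
    exact laurentEquiv_C_mul_T_mem.mp hy.2
  | zero => exact zero_mem _
  | add y z _ _ hy hz => exact add_mem hy hz

theorem IsGradedOverring.laurentOver (hS : IsGradedOverring 𝒜 S) :
    IsGradedOverring (polyGrading 𝒜) (laurentOver S) := by
  rw [isGradedOverring_iff] at hS ⊢
  have h := hS.laurentExtend
  rwa [show laurentExtend (⊤ : Ideal S) = ⊤ from
    (Ideal.eq_top_iff_one _).mpr (by
      rw [← map_one (laurentEquiv S), laurentEquiv_mem_laurentExtend]; simp)] at h

theorem GrLocalOver.laurentOver (hS : GrLocalOver 𝒜 S) :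
    GrLocalOver (polyGrading 𝒜) (laurentOver S) := by
  obtain ⟨m, ⟨hm, hmtop, hmax⟩, huniq⟩ := hS
  refine ⟨laurentExtend m, ⟨hm.laurentExtend, laurentExtend_ne_top hmtop, ?_⟩, ?_⟩
  · intro J hJ hmJ hJtop
    rw [← hJ.laurentExtend_laurentContract, hmax _ hJ.laurentContract _
      (laurentContract_ne_top hJtop)]
    rw [← laurentContract_laurentExtend m]
    exact laurentContract_mono hmJ
  · rintro J ⟨hJ, hJtop, hJmax⟩
    rw [← hJ.laurentExtend_laurentContract]
    congr 1
    refine huniq _ ⟨hJ.laurentContract, laurentContract_ne_top hJtop, fun I hI hle hItop => ?_⟩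
    rw [← hJmax _ hI.laurentExtend _ (laurentExtend_ne_top hItop), laurentContract_laurentExtend]
    rw [← hJ.laurentExtend_laurentContract]
    exact laurentExtend_mono hle

theorem GGD.laurentOver (hS : GGD 𝒜 S) : GGD (polyGrading 𝒜) (laurentOver S) := by
  rintro P Q Qt hPp hQp hQtp hP hQ hQt hPQ rfl
  have hC (J : Ideal (_root_.laurentOver S)) : (laurentContract J).comap (algebraMap A S) =
      (J.comap (algebraMap (Polynomial A) _)).comap Polynomial.C := by
    ext a
    simp [mem_laurentContract, algebraMap_laurentOver]
  have hXQ : Polynomial.X ∉ Qt.comap (algebraMap (Polynomial A) (_root_.laurentOver S)) := by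
    intro h
    refine hQtp.ne_top (Ideal.eq_top_of_isUnit_mem _ h ?_)
    rw [algebraMap_laurentOver, Polynomial.map_X, Polynomial.toLaurent_X]
    exact (isUnit_T 1).map (laurentEquiv S)
  obtain ⟨hp, hpP⟩ := hP.comap_C fun h => hXQ (hPQ h)
  have := laurentContract_isPrime Qt
  obtain ⟨pt, hptp, hpt, hle, hcomap⟩ := hS (P.comap Polynomial.C) _ (laurentContract Qt)
    (Ideal.comap_isPrime _ _) (Ideal.comap_isPrime _ _) this hp (hQ.comap_C hXQ).1
    hQt.laurentContract (Ideal.comap_mono hPQ) (hC Qt)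
  refine ⟨laurentExtend pt, laurentExtend_isPrime pt, hpt.laurentExtend,
    (laurentExtend_mono hle).trans (laurentExtend_laurentContract_le Qt), ?_⟩
  rw [← hpP, ← hcomap]
  ext f
  rw [Ideal.mem_map_C_iff, Ideal.mem_comap, algebraMap_laurentOver,
    laurentEquiv_mem_laurentExtend]
  simp only [forall_coeff_toLaurent_mem, Polynomial.coeff_map, Ideal.mem_comap]

theorem IsLocalizationOfR.of_laurentOver (h : IsLocalizationOfR (laurentOver S)) :
    IsLocalizationOfR S := by
  obtain ⟨W, hW, hS⟩ := h
  refine ⟨W.map (Polynomial.evalRingHom 1), ?_, fun s => ?_⟩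
  · rintro _ ⟨w, hw, rfl⟩
    exact laurentEvalOne_algebraMap (S := S) w ▸ (hW w hw).map (laurentEvalOne S)
  · obtain ⟨r, w, hw, hrw⟩ := hS (laurentEquiv S (C s))
    refine ⟨Polynomial.evalRingHom 1 r, Polynomial.evalRingHom 1 w, ⟨w, hw, rfl⟩, ?_⟩
    rw [← laurentEvalOne_algebraMap, ← laurentEvalOne_algebraMap, ← hrw, map_mul,
      laurentEvalOne_C]

end LaurentExtension

/-- Let `A` be a `G`-graded domain and endow `A[X]` with the natural
`G × ℤ≥0` grading. If `A[X]` is a graded perinormal domain, then `A` is a graded perinormal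
domain. -/
theorem gradedPerinormal_of_polynomial_gradedPerinormal
    {G : Type*} [DecidableEq G] [AddCommGroup G] (hG : ∀ g : G, g ≠ 0 → ¬IsOfFinAddOrder g)
    {A : Type*} [CommRing A] [IsDomain A]
    (𝒜 : G → AddSubgroup A) (hGr : IsGrRing 𝒜)
    (hpoly : GradedPerinormal (polyGrading 𝒜)) :
    GradedPerinormal 𝒜 := by
  exact fun S hS hloc hgd =>
    (hpoly _ hS.laurentOver hloc.laurentOver hgd.laurentOver).of_laurentOver
end

section
/- Let A be an integral domain. If the polynomial ring A[X₁, ..., X_n] with its natural ℤ_{≥0}^n multigrading (each monomial homogeneous of degree equal to its exponent vector) is a graded perinormal domain, then A is a perinormal domain. -/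
/-- The natural `ℤ≥0ⁿ` multigrading on `A[X₁, …, Xₙ]` (indexed by the group `ℤⁿ`): each
monomial is homogeneous of degree its exponent vector. -/
def mvGrading (A : Type*) [CommRing A] (n : ℕ) :
    (Fin n → ℤ) → AddSubgroup (MvPolynomial (Fin n) A) := fun d =>
  { carrier := {p | p = 0 ∨ ∃ (m : Fin n →₀ ℕ) (a : A), (∀ i, (m i : ℤ) = d i) ∧
      p = MvPolynomial.monomial m a}
    zero_mem' := Or.inl rfl
    add_mem' := by
      rintro p q (rfl | ⟨m, a, hm, rfl⟩) hq
      · simpa using hq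
      · rcases hq with rfl | ⟨m', b, hm', rfl⟩
        · exact Or.inr ⟨m, a, hm, by simp⟩
        · obtain rfl : m = m' := Finsupp.ext fun i => by exact_mod_cast (hm i).trans (hm' i).symm
          exact Or.inr ⟨m, a + b, hm, by rw [map_add]⟩
    neg_mem' := by
      rintro p (rfl | ⟨m, a, hm, rfl⟩)
      · exact Or.inl neg_zero
      · exact Or.inr ⟨m, -a, hm, by rw [map_neg]⟩ }

namespace MvPolynomial

attribute [local instance] algebraMvPolynomial

variable {A : Type*} [CommRing A] [IsDomain A] {n : ℕ}

theorem isUnit_algebraMap_of_mem_map_C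
    (y : (nonZeroDivisors A).map (C : A →+* MvPolynomial (Fin n) A)) :
    IsUnit (algebraMap (MvPolynomial (Fin n) A) (FractionRing (MvPolynomial (Fin n) A)) y) := by
  obtain ⟨_, a, ha, rfl⟩ := y
  refine IsUnit.mk0 _ ?_
  simpa using nonZeroDivisors.ne_zero ha

/-- The inclusion of `K[X₁, …, Xₙ]` into the quotient field of `A[X₁, …, Xₙ]`, where `K` is the
quotient field of `A`. -/
noncomputable def toFractionRing (A : Type*) [CommRing A] [IsDomain A] (n : ℕ) :
    MvPolynomial (Fin n) (FractionRing A) →+* FractionRing (MvPolynomial (Fin n) A) :=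
  IsLocalization.lift (M := (nonZeroDivisors A).map (C : A →+* MvPolynomial (Fin n) A))
    isUnit_algebraMap_of_mem_map_C

theorem toFractionRing_map (r : MvPolynomial (Fin n) A) :
    toFractionRing A n (map (algebraMap A (FractionRing A)) r) = algebraMap _ _ r :=
  IsLocalization.lift_eq _ r

theorem toFractionRing_injective : Function.Injective (toFractionRing A n) := by
  refine (IsLocalization.lift_injective_iff _).2 fun x y => ?_
  rw [(IsFractionRing.injective (MvPolynomial (Fin n) A)
    (FractionRing (MvPolynomial (Fin n) A))).eq_iff]
  exact (map_injective _ (IsFractionRing.injective A (FractionRing A))).eq_iff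

theorem isPrime_map_C {B : Type*} [CommRing B] {σ : Type*} {p : Ideal B} (hp : p.IsPrime) :
    (p.map (C : B →+* MvPolynomial σ B)).IsPrime := by
  have : p.map (C : B →+* MvPolynomial σ B) = RingHom.ker (map (Ideal.Quotient.mk p)) := by
    ext f
    simp [mem_map_C_iff, RingHom.mem_ker, MvPolynomial.ext_iff, coeff_map,
      Ideal.Quotient.eq_zero_iff_mem]
  rw [this]
  exact RingHom.ker_isPrime _

theorem mul_monomial_mem_map_C_iff {B : Type*} [CommRing B] {σ : Type*} {p : Ideal B}
    {f : MvPolynomial σ B} {m : σ →₀ ℕ} :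
    f * monomial m 1 ∈ p.map C ↔ f ∈ p.map C := by
  refine ⟨fun h => mem_map_C_iff.2 fun d => ?_, fun h => Ideal.mul_mem_right _ _ h⟩
  simpa using mem_map_C_iff.1 h (d + m)

theorem monomial_eq_C_mul_monomial_one {B : Type*} [CommRing B] {σ : Type*} (m : σ →₀ ℕ) (b : B) :
    monomial m b = C b * monomial m 1 := by
  simp [C_mul_monomial]

variable (S : Subalgebra A (FractionRing A))

/-- The inclusion of `S[X₁, …, Xₙ]` into the quotient field of `A[X₁, …, Xₙ]`, for an overring
`S` of `A`. -/
noncomputable def overringHom (n : ℕ) :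
    MvPolynomial (Fin n) S →+* FractionRing (MvPolynomial (Fin n) A) :=
  (toFractionRing A n).comp (map (algebraMap S (FractionRing A)))

theorem overringHom_map (r : MvPolynomial (Fin n) A) :
    overringHom S n (map (algebraMap A S) r) = algebraMap _ _ r := by
  rw [overringHom, RingHom.comp_apply, map_map, ← IsScalarTower.algebraMap_eq, toFractionRing_map]

theorem overringHom_injective : Function.Injective (overringHom S n) :=
  toFractionRing_injective.comp (map_injective _ Subtype.val_injective)

theorem overringHom_monomial_one (m : Fin n →₀ ℕ) :
    overringHom S n (monomial m 1) = algebraMap (MvPolynomial (Fin n) A) _ (monomial m 1) := by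
  rw [← overringHom_map S]
  simp

/-- The exponent vector `(1, …, 1)`. -/
noncomputable def onesExponent (n : ℕ) : Fin n →₀ ℕ := Finsupp.equivFunOnFinite.symm 1

/-- The product `X₁ ⋯ Xₙ` in the quotient field of `A[X₁, …, Xₙ]`. -/
noncomputable def prodVars (A : Type*) [CommRing A] [IsDomain A] (n : ℕ) :
    FractionRing (MvPolynomial (Fin n) A) :=
  algebraMap (MvPolynomial (Fin n) A) _ (monomial (onesExponent n) 1)

theorem prodVars_ne_zero : prodVars A n ≠ 0 := by
  simp [prodVars]

theorem prodVars_pow (k : ℕ) :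
    prodVars A n ^ k = overringHom S n (monomial (k • onesExponent n) 1) := by
  rw [prodVars, ← map_pow, monomial_pow, one_pow, overringHom_monomial_one]

theorem exists_le_nsmul_onesExponent (m : Fin n →₀ ℕ) : ∃ k : ℕ, m ≤ k • onesExponent n := by
  refine ⟨∑ i, m i, fun i => ?_⟩
  simpa [onesExponent] using Finset.single_le_sum (f := m) (fun _ _ => Nat.zero_le _)
    (Finset.mem_univ i)

/-- The Laurent polynomial ring `S[X₁^±1, …, Xₙ^±1]` over an overring `S` of `A`, as an overring
of `A[X₁, …, Xₙ]`. -/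
noncomputable def laurentOverring (n : ℕ) :
    Subalgebra (MvPolynomial (Fin n) A) (FractionRing (MvPolynomial (Fin n) A)) where
  carrier := {x | ∃ (k : ℕ) (f : MvPolynomial (Fin n) S),
    x * prodVars A n ^ k = overringHom S n f}
  mul_mem' := by
    rintro x y ⟨k, f, hf⟩ ⟨l, g, hg⟩
    exact ⟨k + l, f * g, by rw [map_mul, ← hf, ← hg]; ring⟩
  add_mem' := by
    rintro x y ⟨k, f, hf⟩ ⟨l, g, hg⟩
    refine ⟨k + l, f * monomial (l • onesExponent n) 1 + g * monomial (k • onesExponent n) 1, ?_⟩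
    rw [map_add, map_mul, map_mul, ← hf, ← hg, ← prodVars_pow, ← prodVars_pow]
    ring
  algebraMap_mem' r := ⟨0, map (algebraMap A S) r, by rw [overringHom_map]; simp⟩

variable {S}

theorem overringHom_mem (f : MvPolynomial (Fin n) S) :
    overringHom S n f ∈ laurentOverring S n :=
  ⟨0, f, by simp⟩

variable (S) in
/-- The inclusion of `S[X₁, …, Xₙ]` into `S[X₁^±1, …, Xₙ^±1]`. -/
noncomputable def toLaurentOverring (n : ℕ) : MvPolynomial (Fin n) S →+* laurentOverring S n :=
  (overringHom S n).codRestrict _ overringHom_mem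

theorem coe_toLaurentOverring (f : MvPolynomial (Fin n) S) :
    (toLaurentOverring S n f : FractionRing (MvPolynomial (Fin n) A)) = overringHom S n f := rfl

theorem toLaurentOverring_map (r : MvPolynomial (Fin n) A) :
    toLaurentOverring S n (map (algebraMap A S) r) = algebraMap _ _ r :=
  Subtype.ext (overringHom_map S r)

theorem exists_mul_eq_toLaurentOverring (x : laurentOverring S n) :
    ∃ (k : ℕ) (f : MvPolynomial (Fin n) S),
      x * toLaurentOverring S n (monomial (k • onesExponent n) 1) = toLaurentOverring S n f := by
  obtain ⟨x, k, f, h⟩ := x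
  exact ⟨k, f, Subtype.ext (by simpa [coe_toLaurentOverring, ← prodVars_pow] using h)⟩

theorem toLaurentOverring_injective : Function.Injective (toLaurentOverring S n) := fun _ _ h =>
  overringHom_injective S (congrArg Subtype.val h)

theorem isUnit_toLaurentOverring_monomial_one (m : Fin n →₀ ℕ) :
    IsUnit (toLaurentOverring S n (monomial m 1)) := by
  obtain ⟨k, hk⟩ := exists_le_nsmul_onesExponent m
  obtain ⟨d, hd⟩ := exists_add_of_le hk
  have h : IsUnit (toLaurentOverring S n (monomial (k • onesExponent n) 1)) := by
    refine IsUnit.of_mul_eq_one ⟨(prodVars A n ^ k)⁻¹, k, 1, ?_⟩ (Subtype.ext ?_)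
    · rw [map_one, inv_mul_cancel₀ (pow_ne_zero _ prodVars_ne_zero)]
    · change overringHom S n _ * _ = 1
      rw [← prodVars_pow, mul_inv_cancel₀ (pow_ne_zero _ prodVars_ne_zero)]
  rw [hd, ← one_mul (1 : S), ← monomial_mul, map_mul] at h
  exact isUnit_of_mul_isUnit_left h

/-- The extension of an ideal `p` of `S` to `S[X₁^±1, …, Xₙ^±1]`. -/
noncomputable def laurentIdeal (n : ℕ) (p : Ideal S) : Ideal (laurentOverring S n) :=
  (p.map C).map (toLaurentOverring S n)

theorem exists_of_mem_laurentIdeal {p : Ideal S} {x : laurentOverring S n}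
    (hx : x ∈ laurentIdeal n p) : ∃ (k : ℕ) (f : MvPolynomial (Fin n) S), f ∈ p.map C ∧
      x * toLaurentOverring S n (monomial (k • onesExponent n) 1) = toLaurentOverring S n f := by
  refine Submodule.span_induction ?_ ⟨0, 0, zero_mem _, by simp⟩ ?_ ?_ hx
  · rintro _ ⟨f, hf, rfl⟩
    exact ⟨0, f, hf, by simp⟩
  · rintro x y - - ⟨k, f, hf, hxf⟩ ⟨l, g, hg, hyg⟩
    refine ⟨k + l, f * monomial (l • onesExponent n) 1 + g * monomial (k • onesExponent n) 1,
      add_mem (Ideal.mul_mem_right _ _ hf) (Ideal.mul_mem_right _ _ hg), ?_⟩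
    rw [map_add, map_mul, map_mul, ← hxf, ← hyg, add_smul, ← one_mul (1 : S), ← monomial_mul,
      map_mul, one_mul]
    ring
  · rintro a x - ⟨k, f, hf, hxf⟩
    obtain ⟨l, g, hg⟩ := exists_mul_eq_toLaurentOverring a
    refine ⟨l + k, g * f, Ideal.mul_mem_left _ _ hf, ?_⟩
    rw [map_mul, ← hxf, ← hg, add_smul, ← one_mul (1 : S), ← monomial_mul, map_mul, one_mul,
      smul_eq_mul]
    ring

theorem mem_laurentIdeal_iff {p : Ideal S} {x : laurentOverring S n} {m : Fin n →₀ ℕ}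
    {f : MvPolynomial (Fin n) S}
    (h : x * toLaurentOverring S n (monomial m 1) = toLaurentOverring S n f) :
    x ∈ laurentIdeal n p ↔ f ∈ p.map C := by
  constructor
  · intro hx
    obtain ⟨l, g, hg, hxg⟩ := exists_of_mem_laurentIdeal hx
    have : f * monomial (l • onesExponent n) 1 = g * monomial m 1 := by
      apply toLaurentOverring_injective
      rw [map_mul, map_mul, ← h, ← hxg]
      ring
    rw [← mul_monomial_mem_map_C_iff (m := l • onesExponent n), this]
    exact Ideal.mul_mem_right _ _ hg
  · intro hf
    rw [← Ideal.mul_unit_mem_iff_mem _ (isUnit_toLaurentOverring_monomial_one m), h]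
    exact Ideal.mem_map_of_mem _ hf

theorem toLaurentOverring_mem_laurentIdeal_iff {p : Ideal S} {f : MvPolynomial (Fin n) S} :
    toLaurentOverring S n f ∈ laurentIdeal n p ↔ f ∈ p.map C :=
  mem_laurentIdeal_iff (m := 0) (by simp)

theorem laurentIdeal_isPrime {p : Ideal S} (hp : p.IsPrime) : (laurentIdeal n p).IsPrime := by
  have hP := isPrime_map_C (σ := Fin n) hp
  refine ⟨?_, fun {x y} hxy => ?_⟩
  · rw [Ideal.ne_top_iff_one, ← map_one (toLaurentOverring S n),
      toLaurentOverring_mem_laurentIdeal_iff, ← Ideal.ne_top_iff_one]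
    exact hP.ne_top
  · obtain ⟨k, f, hf⟩ := exists_mul_eq_toLaurentOverring x
    obtain ⟨l, g, hg⟩ := exists_mul_eq_toLaurentOverring y
    rw [mem_laurentIdeal_iff hf, mem_laurentIdeal_iff hg]
    refine hP.mem_or_mem ((mem_laurentIdeal_iff
      (m := k • onesExponent n + l • onesExponent n) ?_).1 hxy)
    rw [map_mul, ← hf, ← hg, ← one_mul (1 : S), ← monomial_mul, map_mul, one_mul]
    ring

theorem monomial_mem_mvGrading {B : Type*} [CommRing B] (m : Fin n →₀ ℕ) (a : B) :
    monomial m a ∈ mvGrading B n (fun i => (m i : ℤ)) :=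
  Or.inr ⟨m, a, fun _ => rfl, rfl⟩

theorem exists_eq_monomial_of_mem_mvGrading {B : Type*} [CommRing B] {d : Fin n → ℤ}
    {p : MvPolynomial (Fin n) B} (hp : p ∈ mvGrading B n d) :
    ∃ (m : Fin n →₀ ℕ) (a : B), p = monomial m a := by
  rcases hp with rfl | ⟨m, a, -, rfl⟩
  · exact ⟨0, 0, by simp⟩
  · exact ⟨m, a, rfl⟩

theorem isHomFrac_of_mul_eq {x : laurentOverring S n} {m d : Fin n →₀ ℕ} {s : S}
    (h : x * toLaurentOverring S n (monomial m 1) = toLaurentOverring S n (monomial d s)) :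
    IsHomFrac (mvGrading A n) (x : FractionRing (MvPolynomial (Fin n) A)) := by
  obtain ⟨⟨a, b⟩, hab⟩ := IsLocalization.surj (nonZeroDivisors A) (s : FractionRing A)
  refine ⟨_, _, _, _, monomial_mem_mvGrading d a, monomial_mem_mvGrading m (b : A), by simp, ?_⟩
  have hs : s * algebraMap A S b = algebraMap A S a := Subtype.ext hab
  have hx : x * toLaurentOverring S n (monomial m (algebraMap A S b)) =
      toLaurentOverring S n (monomial d (algebraMap A S a)) := by
    rw [monomial_eq_C_mul_monomial_one m, mul_comm (C _), map_mul, ← mul_assoc, h, ← map_mul,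
      mul_comm, C_mul_monomial, mul_comm, hs]
  simpa [coe_toLaurentOverring, ← overringHom_map S] using congrArg Subtype.val hx

theorem exists_monomial_of_isHomFrac {x : laurentOverring S n}
    (hx : IsHomFrac (mvGrading A n) (x : FractionRing (MvPolynomial (Fin n) A))) :
    ∃ (m d : Fin n →₀ ℕ) (s : S),
      x * toLaurentOverring S n (monomial m 1) = toLaurentOverring S n (monomial d s) := by
  classical
  obtain ⟨i, j, a, b, ha, hb, hb0, h⟩ := hx
  obtain ⟨m, a, rfl⟩ := exists_eq_monomial_of_mem_mvGrading ha
  obtain ⟨d, b, rfl⟩ := exists_eq_monomial_of_mem_mvGrading hb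
  obtain ⟨k, f, hf⟩ := exists_mul_eq_toLaurentOverring x
  have hb' : algebraMap A S b ≠ 0 := by
    have : b ≠ 0 := by simpa using hb0
    simpa using this
  have hx : x * toLaurentOverring S n (monomial d (algebraMap A S b)) =
      toLaurentOverring S n (monomial m (algebraMap A S a)) := by
    refine Subtype.ext ?_
    simpa [coe_toLaurentOverring, ← overringHom_map S] using h
  have key : f * monomial d (algebraMap A S b) =
      monomial (m + k • onesExponent n) (algebraMap A S a) := by
    apply toLaurentOverring_injective
    rw [map_mul, ← hf, mul_right_comm, hx, ← map_mul, monomial_mul, mul_one]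
  have hcoeff (e : Fin n →₀ ℕ) (he : coeff e f ≠ 0) : e + d = m + k • onesExponent n := by
    have := congrArg (coeff (e + d)) key
    rw [coeff_mul_monomial, coeff_monomial] at this
    by_contra hne
    rw [if_neg (Ne.symm hne)] at this
    exact mul_ne_zero he hb' this
  by_cases hf0 : f = 0
  · exact ⟨k • onesExponent n, 0, 0, by simp [hf, hf0]⟩
  · obtain ⟨e, he⟩ := ne_zero_iff.1 hf0
    refine ⟨k • onesExponent n, e, coeff e f, hf.trans (congrArg _ ?_)⟩
    ext e' : 1
    rw [coeff_monomial]
    split_ifs with hee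
    · rw [hee]
    · by_contra hne
      exact hee (add_right_cancel ((hcoeff e he).trans (hcoeff e' hne).symm))

theorem mem_closure_isHomFrac_of_mem_laurentIdeal {p : Ideal S} {x : laurentOverring S n}
    (hx : x ∈ laurentIdeal n p) : (x : FractionRing (MvPolynomial (Fin n) A)) ∈
      AddSubmonoid.closure {y | IsHomFrac (mvGrading A n) y ∧
        ∃ h : y ∈ laurentOverring S n, (⟨y, h⟩ : laurentOverring S n) ∈ laurentIdeal n p} := by
  obtain ⟨k, f, hf, hxf⟩ := exists_of_mem_laurentIdeal hx
  obtain ⟨u, hu⟩ := isUnit_toLaurentOverring_monomial_one (S := S) (k • onesExponent n)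
  rw [← hu, ← Units.eq_mul_inv_iff_mul_eq, as_sum f, map_sum, Finset.sum_mul] at hxf
  rw [hxf, AddSubmonoidClass.coe_finsetSum]
  refine sum_mem fun d _ => AddSubmonoid.subset_closure ?_
  have hd : toLaurentOverring S n (monomial d (coeff d f)) * ↑u⁻¹ *
      toLaurentOverring S n (monomial (k • onesExponent n) 1) =
      toLaurentOverring S n (monomial d (coeff d f)) := by
    rw [← hu, Units.inv_mul_cancel_right]
  refine ⟨isHomFrac_of_mul_eq hd, Subtype.property _, ?_⟩
  refine (mem_laurentIdeal_iff hd).2 ?_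
  rw [monomial_eq_C_mul_monomial_one]
  exact Ideal.mul_mem_right _ _ (Ideal.mem_map_of_mem _ (mem_map_C_iff.1 hf d))

theorem laurentIdeal_isHomIdealOver (p : Ideal S) :
    IsHomIdealOver (mvGrading A n) (laurentOverring S n) (laurentIdeal n p) := fun _ hx =>
  mem_closure_isHomFrac_of_mem_laurentIdeal hx

theorem laurentIdeal_top : laurentIdeal n (⊤ : Ideal S) = ⊤ := by
  simp [laurentIdeal, Ideal.map_top]

theorem laurentOverring_isGradedOverring :
    IsGradedOverring (mvGrading A n) (laurentOverring S n) := fun x hx => by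
  refine AddSubmonoid.closure_mono ?_ (mem_closure_isHomFrac_of_mem_laurentIdeal (p := ⊤)
    (x := ⟨x, hx⟩) (by rw [laurentIdeal_top]; trivial))
  exact fun y ⟨hy, h, _⟩ => ⟨h, hy⟩

/-- The contraction of an ideal of `S[X₁^±1, …, Xₙ^±1]` to `S`. -/
noncomputable def contractLaurent (I : Ideal (laurentOverring S n)) : Ideal S :=
  I.comap ((toLaurentOverring S n).comp C)

theorem laurentIdeal_contractLaurent_le (I : Ideal (laurentOverring S n)) :
    laurentIdeal n (contractLaurent I) ≤ I := by
  rw [laurentIdeal, Ideal.map_map]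
  exact Ideal.map_comap_le

theorem le_laurentIdeal_contractLaurent {I : Ideal (laurentOverring S n)}
    (hI : IsHomIdealOver (mvGrading A n) (laurentOverring S n) I) :
    I ≤ laurentIdeal n (contractLaurent I) := by
  intro x hx
  have key : AddSubmonoid.closure {y : FractionRing (MvPolynomial (Fin n) A) |
      IsHomFrac (mvGrading A n) y ∧
        ∃ h : y ∈ laurentOverring S n, (⟨y, h⟩ : laurentOverring S n) ∈ I} ≤
      (laurentIdeal n (contractLaurent I)).toAddSubmonoid.map
        (laurentOverring S n).val.toAddMonoidHom := by
    rw [AddSubmonoid.closure_le]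
    rintro y ⟨hy, h, hyI⟩
    refine ⟨⟨y, h⟩, ?_, rfl⟩
    obtain ⟨m, d, s, hs⟩ := exists_monomial_of_isHomFrac (x := ⟨y, h⟩) hy
    refine (mem_laurentIdeal_iff hs).2 ?_
    have hsI : toLaurentOverring S n (monomial d s) ∈ I := hs ▸ I.mul_mem_right _ hyI
    rw [monomial_eq_C_mul_monomial_one, map_mul,
      Ideal.mul_unit_mem_iff_mem _ (isUnit_toLaurentOverring_monomial_one d)] at hsI
    rw [monomial_eq_C_mul_monomial_one]
    exact Ideal.mul_mem_right _ _ (Ideal.mem_map_of_mem _ hsI)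
  obtain ⟨z, hz, hzx⟩ := key (hI x hx)
  exact (Subtype.ext hzx : z = x) ▸ hz

theorem laurentIdeal_mono {p q : Ideal S} (h : p ≤ q) : laurentIdeal n p ≤ laurentIdeal n q :=
  Ideal.map_mono (Ideal.map_mono h)

theorem laurentOverring_grLocalOver [IsLocalRing S] :
    GrLocalOver (mvGrading A n) (laurentOverring S n) := by
  have le (J : Ideal (laurentOverring S n)) (hJ : IsHomIdealOver (mvGrading A n) _ J)
      (hJ' : J ≠ ⊤) : J ≤ laurentIdeal n (IsLocalRing.maximalIdeal S) :=
    (le_laurentIdeal_contractLaurent hJ).trans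
      (laurentIdeal_mono (IsLocalRing.le_maximalIdeal (Ideal.comap_ne_top _ hJ')))
  have hM := laurentIdeal_isHomIdealOver (n := n) (IsLocalRing.maximalIdeal S)
  have hM' := (laurentIdeal_isPrime (n := n)
    (IsLocalRing.maximalIdeal.isMaximal S).isPrime).ne_top
  exact ⟨_, ⟨hM, hM', fun J hJ hMJ hJ' => (le J hJ hJ').antisymm hMJ⟩,
    fun I ⟨hI, hI', hmax⟩ => (hmax _ hM (le I hI hI') hM').symm⟩

theorem map_C_comap_C_eq {B : Type*} [CommRing B] {P : Ideal (MvPolynomial (Fin n) B)}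
    (hP : P.IsPrime) (hhom : IsHomIdeal (mvGrading B n) P) (hmon : ∀ m, monomial m 1 ∉ P) :
    (P.comap C).map C = P := by
  refine Ideal.map_comap_le.antisymm fun x hx => ?_
  refine (AddSubmonoid.closure_le (S := ((P.comap C).map C).toAddSubmonoid)).2 ?_ (hhom x hx)
  rintro y ⟨⟨i, hy⟩, hyP⟩
  obtain ⟨m, a, rfl⟩ := exists_eq_monomial_of_mem_mvGrading hy
  rw [monomial_eq_C_mul_monomial_one] at hyP ⊢
  exact Ideal.mul_mem_right _ _ (Ideal.mem_map_of_mem _ ((hP.mem_or_mem hyP).resolve_right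
    (hmon m)))

theorem comap_laurentIdeal (p : Ideal S) :
    (laurentIdeal n p).comap (algebraMap (MvPolynomial (Fin n) A) (laurentOverring S n)) =
      (p.comap (algebraMap A S)).map C := by
  ext r
  rw [Ideal.mem_comap, ← toLaurentOverring_map, toLaurentOverring_mem_laurentIdeal_iff,
    mem_map_C_iff, mem_map_C_iff]
  simp [coeff_map]

theorem comap_contractLaurent (I : Ideal (laurentOverring S n)) :
    (contractLaurent I).comap (algebraMap A S) =
      (I.comap (algebraMap (MvPolynomial (Fin n) A) (laurentOverring S n))).comap C := by
  ext a
  simp [contractLaurent, Ideal.mem_comap, ← toLaurentOverring_map]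

theorem laurentOverring_ggd (hS : GoingDownOver S) :
    GGD (mvGrading A n) (laurentOverring S n) := by
  rintro P Q Qt hP hQ hQt hPhom - - hPQ rfl
  have hmon (m) : monomial m 1 ∉ P := fun hm => by
    have h := hPQ hm
    rw [Ideal.mem_comap, ← toLaurentOverring_map, map_monomial, map_one] at h
    exact hQt.ne_top (Ideal.eq_top_of_isUnit_mem _ h (isUnit_toLaurentOverring_monomial_one m))
  obtain ⟨pt, hpt, hle, hcomap⟩ := hS (P.comap C) _ (contractLaurent Qt) (hP.comap C)
    ((hQt.comap _).comap _) (hQt.comap _) (Ideal.comap_mono hPQ) (comap_contractLaurent Qt)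
  refine ⟨laurentIdeal n pt, laurentIdeal_isPrime hpt, laurentIdeal_isHomIdealOver pt,
    (laurentIdeal_mono hle).trans (laurentIdeal_contractLaurent_le Qt), ?_⟩
  rw [comap_laurentIdeal, hcomap, map_C_comap_C_eq hP hPhom hmon]

theorem isLocalizationOfR_of_laurentOverring [IsLocalRing S]
    (h : IsLocalizationOfR (laurentOverring S n)) : IsLocalizationOfR S := by
  obtain ⟨W, hW, hsurj⟩ := h
  refine ⟨((IsLocalRing.maximalIdeal S).comap (algebraMap A S)).primeCompl, fun w hw => ?_,
    fun s => ?_⟩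
  · exact not_not.1 hw
  · obtain ⟨r, w, hw, hrw⟩ := hsurj (toLaurentOverring S n (C s))
    rw [← toLaurentOverring_map, ← toLaurentOverring_map, ← map_mul] at hrw
    have hwM : w ∉ ((IsLocalRing.maximalIdeal S).comap (algebraMap A S)).map C := by
      rw [← comap_laurentIdeal]
      intro hmem
      exact (laurentIdeal_isPrime (n := n)
        (IsLocalRing.maximalIdeal.isMaximal S).isPrime).ne_top
          (Ideal.eq_top_of_isUnit_mem _ hmem (hW w hw))
    rw [mem_map_C_iff, not_forall] at hwM
    obtain ⟨m, hm⟩ := hwM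
    refine ⟨coeff m r, coeff m w, hm, ?_⟩
    simpa [coeff_C_mul, coeff_map] using congrArg (coeff m) (toLaurentOverring_injective hrw)

end MvPolynomial

/-- Let `A` be an integral domain. If `A[X₁, …, Xₙ]` with its natural
`ℤ≥0ⁿ` multigrading is a graded perinormal domain, then `A` is a perinormal domain. -/
theorem perinormal_of_mvPolynomial_gradedPerinormal
    (A : Type*) [CommRing A] [IsDomain A] (n : ℕ)
    (h : GradedPerinormal (mvGrading A n)) :
    Perinormal A := fun S _ hGD =>
  MvPolynomial.isLocalizationOfR_of_laurentOverring
    (h (MvPolynomial.laurentOverring S n) MvPolynomial.laurentOverring_isGradedOverring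
      MvPolynomial.laurentOverring_grLocalOver (MvPolynomial.laurentOverring_ggd hGD))
end
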